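/- (Local Euler-Maclaurin formula) Let p be a rational polytope in V. For every polynomial function h on V, Σ_{x ∈ p∩Λ} h(x) = Σ_{f ∈ F(p)} ∫_f D(p,f)·h, where the sum is over all faces f of p, the integral over f is taken with respect to the canonical Lebesgue measure on <f> determined by the lattice Λ ∩ lin(f), and D(p,f) is the infinite-order constant-coefficient differential operator on V whose symbol is μ(t(p,f)), i.e. D(p,f)·e^ξ = μ(t(p,f))(ξ) e^ξ for ξ small. -/

import Mathlib

open MeasureTheory Filter Topology Set
open scoped RealInnerProductSpace Pointwise BigOperators

noncomputable section

/-- the ambient rational vector space: `ℝ^d` with the standard inner product, which is used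
to identify `V` with its dual space `V^*`. -/
abbrev Vd (d : ℕ) := EuclideanSpace ℝ (Fin d)

variable {d : ℕ}

/-- the duality pairing `⟨ξ, x⟩` between `V^*` and `V`, realized by the standard inner
product of `ℝ^d`. -/
def pairE {d : ℕ} (ξ x : Vd d) : ℝ := @inner ℝ _ _ ξ x

/-- `Λ` is a lattice of its span: it is generated by finitely many `ℝ`-independent vectors. -/
def IsLatticeSub (Λ : AddSubgroup (Vd d)) : Prop :=
  ∃ (k : ℕ) (v : Fin k → Vd d), LinearIndependent ℝ v ∧
    Λ = AddSubgroup.closure (Set.range v)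

/-- `Λ` is a full-rank lattice in `ℝ^d`. -/
def IsFullLattice (Λ : AddSubgroup (Vd d)) : Prop :=
  IsLatticeSub Λ ∧ Submodule.span ℝ (Λ : Set (Vd d)) = ⊤

/-- `x` is a rational point with respect to the lattice `Λ`. -/
def IsRatPoint (Λ : AddSubgroup (Vd d)) (x : Vd d) : Prop :=
  ∃ q : ℤ, q ≠ 0 ∧ (q : ℝ) • x ∈ Λ

/-- viewing `φ ∈ V` as a linear functional via the standard pairing, it takes integer values
on `Λ`, i.e. it belongs to the dual lattice. -/
def IsDualIntegral (Λ : AddSubgroup (Vd d)) (φ : Vd d) : Prop :=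
  ∀ x ∈ Λ, ∃ n : ℤ, (pairE (φ) (x)) = (n : ℝ)

/-- a rational polyhedron (inside the span of `Λ`): a finite intersection of half-spaces
bounded by rational affine hyperplanes. -/
def IsRatPolyhedron (Λ : AddSubgroup (Vd d)) (P : Set (Vd d)) : Prop :=
  ∃ (n : ℕ) (φ : Fin n → Vd d) (c : Fin n → ℚ),
    (∀ i, IsDualIntegral Λ (φ i)) ∧
    P = {x | x ∈ Submodule.span ℝ (Λ : Set (Vd d)) ∧ ∀ i, (pairE (φ i) x) ≤ (c i : ℝ)}

/-- the set `P` contains a straight (affine) line. -/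
def ContainsLine (P : Set (Vd d)) : Prop :=
  ∃ x u : Vd d, u ≠ 0 ∧ ∀ t : ℝ, x + t • u ∈ P

/-- equality of meromorphic-type functions near `0`: they agree near `0` outside a closed
set with empty interior (the polar set). -/
def MeroEqAt0 (f g : Vd d → ℝ) : Prop :=
  ∃ Z : Set (Vd d), IsClosed Z ∧ interior Z = ∅ ∧
    ∀ᶠ ξ in 𝓝 (0 : Vd d), ξ ∉ Z → f ξ = g ξ

/-- `g` is analytic at `0` and its Taylor coefficients are rational with respect to an
integral basis (i.e. the coefficients take rational values on dual-lattice vectors). -/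
def HasRatSeriesAt0 (Λ : AddSubgroup (Vd d)) (g : Vd d → ℝ) : Prop :=
  ∃ p : FormalMultilinearSeries ℝ (Vd d) ℝ, HasFPowerSeriesAt g p 0 ∧
    ∀ (n : ℕ) (w : Fin n → Vd d), (∀ i, IsDualIntegral Λ (w i)) →
      ∃ q : ℚ, (p n) w = (q : ℝ)

/-- `f` is meromorphic near `0` with rational Taylor coefficients: near `0` it is a quotient
of two analytic functions with rational Taylor coefficients. -/
def RatMeromorphicAt0 (Λ : AddSubgroup (Vd d)) (f : Vd d → ℝ) : Prop :=
  ∃ g h : Vd d → ℝ, HasRatSeriesAt0 Λ g ∧ HasRatSeriesAt0 Λ h ∧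
    (¬ ∀ᶠ ξ in 𝓝 (0 : Vd d), h ξ = 0) ∧
    (∀ᶠ ξ in 𝓝 (0 : Vd d), h ξ ≠ 0 → f ξ * h ξ = g ξ)

/-- `m` is the canonical Lebesgue measure carried by the rational affine subspace `A`,
normalized so that a fundamental parallelepiped of the lattice `Λ ∩ lin(A)` has volume `1`:
it is the image of the standard Lebesgue measure under a `ℤ`-basis parametrization. -/
def IsCanonicalMeasure (Λ : AddSubgroup (Vd d)) (A : Set (Vd d)) (m : Measure (Vd d)) : Prop :=
  ∃ (k : ℕ) (x₀ : Vd d) (v : Fin k → Vd d),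
    x₀ ∈ A ∧ (∀ i, v i ∈ Λ) ∧ LinearIndependent ℝ v ∧
    A = {x | ∃ t : Fin k → ℝ, x = x₀ + ∑ i, t i • v i} ∧
    (∀ y ∈ Λ, y ∈ Submodule.span ℝ (Set.range v) →
      ∃ c : Fin k → ℤ, y = ∑ i, (c i : ℝ) • v i) ∧
    m = Measure.map (fun t : Fin k → ℝ => x₀ + ∑ i, t i • v i) volume

/-- the characterizing properties of the map `I`: it sends rational polyhedra to meromorphic
functions with rational coefficients, vanishes on polyhedra containing lines, and is given by
`∫_P e^{⟨ξ,x⟩} dm_{<P>}(x)` wherever this integral converges. -/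
def IsIMap (Λ : AddSubgroup (Vd d)) (I : Set (Vd d) → Vd d → ℝ) : Prop :=
  (∀ P, IsRatPolyhedron Λ P → RatMeromorphicAt0 Λ (I P)) ∧
  (∀ P, IsRatPolyhedron Λ P → ContainsLine P → ∀ ξ, I P ξ = 0) ∧
  (∀ P, IsRatPolyhedron Λ P → ∀ m : Measure (Vd d),
    IsCanonicalMeasure Λ ((affineSpan ℝ P : AffineSubspace ℝ (Vd d)) : Set (Vd d)) m →
    ∀ ξ : Vd d, IntegrableOn (fun x => Real.exp (pairE (ξ) (x))) P m →
      I P ξ = ∫ x in P, Real.exp (pairE (ξ) (x)) ∂m)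

/-- the characterizing properties of the map `S`: it sends rational polyhedra to meromorphic
functions with rational coefficients, vanishes on polyhedra containing lines, and is given by
`∑_{x ∈ P ∩ Λ} e^{⟨ξ,x⟩}` wherever this sum converges absolutely. -/
def IsSMap (Λ : AddSubgroup (Vd d)) (S : Set (Vd d) → Vd d → ℝ) : Prop :=
  (∀ P, IsRatPolyhedron Λ P → RatMeromorphicAt0 Λ (S P)) ∧
  (∀ P, IsRatPolyhedron Λ P → ContainsLine P → ∀ ξ, S P ξ = 0) ∧
  (∀ P, IsRatPolyhedron Λ P → ∀ ξ : Vd d,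
    Summable (fun x : ↥(P ∩ (Λ : Set (Vd d))) => Real.exp (pairE ξ (x : Vd d))) →
      S P ξ = ∑' x : ↥(P ∩ (Λ : Set (Vd d))), Real.exp (pairE ξ (x : Vd d)))

/-- `F` is a (nonempty, exposed) face of the convex set `P`. -/
def IsFaceOf (P F : Set (Vd d)) : Prop :=
  F.Nonempty ∧ ∃ φ : Vd d, F = {x ∈ P | ∀ y ∈ P, (pairE (φ) (y)) ≤ (pairE (φ) (x))}

/-- `v` is a vertex of `P`. -/
def IsVertexOf (P : Set (Vd d)) (v : Vd d) : Prop := IsFaceOf P {v}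

/-- the cone of feasible directions of `P` along the face `F` (computed at a point of the
relative interior of `F`). -/
def feasibleCone (P F : Set (Vd d)) : Set (Vd d) :=
  {u | ∃ x ∈ intrinsicInterior ℝ F, ∃ ε : ℝ, 0 < ε ∧ ∀ t : ℝ, 0 < t → t ≤ ε → x + t • u ∈ P}

/-- the supporting cone `<F> + c(P,F)` of `P` along its face `F`. -/
def suppCone (P F : Set (Vd d)) : Set (Vd d) :=
  {z | ∃ a ∈ (affineSpan ℝ F : Set (Vd d)), ∃ u ∈ feasibleCone P F, z = a + u}

/-- the recession cone (cone of directions) of a convex set. -/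
def recCone (P : Set (Vd d)) : Set (Vd d) :=
  {u | ∀ x ∈ P, ∀ t : ℝ, 0 ≤ t → x + t • u ∈ P}

/-- a rational affine cone with respect to the lattice `Λ`: a rational translate of a cone
generated by finitely many lattice vectors. -/
def IsRatAffineCone (Λ : AddSubgroup (Vd d)) (a : Set (Vd d)) : Prop :=
  ∃ (s : Vd d) (n : ℕ) (v : Fin n → Vd d), IsRatPoint Λ s ∧ (∀ i, v i ∈ Λ) ∧
    a = {x | ∃ t : Fin n → ℝ, (∀ i, 0 ≤ t i) ∧ x = s + ∑ i, t i • v i}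

/-- a rational (convex polyhedral) cone with vertex at the origin. -/
def IsRatCone (Λ : AddSubgroup (Vd d)) (c : Set (Vd d)) : Prop :=
  ∃ (n : ℕ) (v : Fin n → Vd d), (∀ i, v i ∈ Λ) ∧
    c = {x | ∃ t : Fin n → ℝ, (∀ i, 0 ≤ t i) ∧ x = ∑ i, t i • v i}

/-- `Q` is a rational scalar product: a symmetric positive definite bilinear form taking
rational values on lattice vectors. -/
def IsRatInner (Λ : AddSubgroup (Vd d)) (Q : Vd d →ₗ[ℝ] Vd d →ₗ[ℝ] ℝ) : Prop :=
  (∀ x y, Q x y = Q y x) ∧ (∀ x : Vd d, x ≠ 0 → 0 < Q x x) ∧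
  (∀ x ∈ Λ, ∀ y ∈ Λ, ∃ q : ℚ, Q x y = (q : ℝ))

/-- `π` realizes the quotient map `V → V/L` as the `Q`-orthogonal projection onto the
`Q`-orthogonal complement of `L`. -/
def IsQCoproj (Q : Vd d →ₗ[ℝ] Vd d →ₗ[ℝ] ℝ) (L : Submodule ℝ (Vd d))
    (π : Vd d →ₗ[ℝ] Vd d) : Prop :=
  (∀ x, x - π x ∈ L) ∧ (∀ x : Vd d, ∀ y ∈ L, Q (π x) y = 0)

/-- `Λ'` is the lattice of a rational quotient space of `(V, Λ)`, realized inside `V` via the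
`Q`-orthogonal projection along a rational subspace. -/
def IsQuotLattice (Q : Vd d →ₗ[ℝ] Vd d →ₗ[ℝ] ℝ) (Λ Λ' : AddSubgroup (Vd d)) : Prop :=
  ∃ (L : Submodule ℝ (Vd d)) (π : Vd d →ₗ[ℝ] Vd d),
    Submodule.span ℝ ((L : Set (Vd d)) ∩ (Λ : Set (Vd d))) = L ∧
    IsQCoproj Q L π ∧ Λ' = AddSubgroup.map π.toAddMonoidHom Λ

/-- a family of maps `I` indexed by the rational quotient spaces of `(V,Λ)`, each member
satisfying the characterizing properties of the integral generating function. -/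
def IsIFamily (Q : Vd d →ₗ[ℝ] Vd d →ₗ[ℝ] ℝ) (Λ : AddSubgroup (Vd d))
    (I : AddSubgroup (Vd d) → Set (Vd d) → Vd d → ℝ) : Prop :=
  ∀ Λ', IsQuotLattice Q Λ Λ' → IsIMap Λ' (I Λ')

/-- a family of maps `S` indexed by the rational quotient spaces of `(V,Λ)`, each member
satisfying the characterizing properties of the lattice-point generating function. -/
def IsSFamily (Q : Vd d →ₗ[ℝ] Vd d →ₗ[ℝ] ℝ) (Λ : AddSubgroup (Vd d))
    (S : AddSubgroup (Vd d) → Set (Vd d) → Vd d → ℝ) : Prop :=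
  ∀ Λ', IsQuotLattice Q Λ Λ' → IsSMap Λ' (S Λ')

/-- the defining properties (a),(b),(c) of the family `μ` of Berline--Vergne:
each `μ(a)` is meromorphic with rational coefficients near `0`, `μ_{0}({0}) = 1`, and for
every pointed rational affine cone `a` in a rational quotient `W` of `V` one has
`S(a) = ∑_{f ∈ F(a)} μ(t(a,f)) I(f)`, where the transverse cone `t(a,f)` is realized inside
`V` by the `Q`-orthogonal projection `π F` along `lin(f)`, and functions on quotient duals
are extended by `Q`-orthogonal projection. -/
def IsMuCore (Λ : AddSubgroup (Vd d)) (Q : Vd d →ₗ[ℝ] Vd d →ₗ[ℝ] ℝ)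
    (I S μ : AddSubgroup (Vd d) → Set (Vd d) → Vd d → ℝ) : Prop :=
  (∀ Λ', IsQuotLattice Q Λ Λ' → ∀ a, IsRatAffineCone Λ' a → ¬ ContainsLine a →
      RatMeromorphicAt0 Λ' (μ Λ' a)) ∧
  (∀ ξ, μ ⊥ ({0} : Set (Vd d)) ξ = 1) ∧
  (∀ Λ', IsQuotLattice Q Λ Λ' → ∀ a, IsRatAffineCone Λ' a → ¬ ContainsLine a →
    ∀ π : Set (Vd d) → (Vd d →ₗ[ℝ] Vd d),
      (∀ F, IsFaceOf a F → IsQCoproj Q (affineSpan ℝ F).direction (π F)) →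
      MeroEqAt0 (S Λ' a)
        (fun ξ => ∑ᶠ F ∈ {F | IsFaceOf a F},
          μ (AddSubgroup.map (π F).toAddMonoidHom Λ') ((π F) '' suppCone a F) ξ
            * I Λ' F ξ))

/-- the family `μ`, extended by `μ(a) = 0` on cones containing a straight line. -/
def IsMuFamily (Λ : AddSubgroup (Vd d)) (Q : Vd d →ₗ[ℝ] Vd d →ₗ[ℝ] ℝ)
    (I S μ : AddSubgroup (Vd d) → Set (Vd d) → Vd d → ℝ) : Prop :=
  IsMuCore Λ Q I S μ ∧
  (∀ Λ', IsQuotLattice Q Λ Λ' → ∀ a, IsRatAffineCone Λ' a → ContainsLine a →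
    ∀ ξ, μ Λ' a ξ = 0)

/-- the trace pairing of two `n`-multilinear forms on `ℝ^d`, computed in the standard basis. -/
def multiPair {n : ℕ} (p q : ContinuousMultilinearMap ℝ (fun _ : Fin n => Vd d) ℝ) : ℝ :=
  ∑ ι : Fin n → Fin d,
    p (fun j => (EuclideanSpace.basisFun (Fin d) ℝ) (ι j)) *
    q (fun j => (EuclideanSpace.basisFun (Fin d) ℝ) (ι j))

/-- the action on `h` of the infinite-order constant-coefficient differential operator whose
symbol has Taylor series `p` at `0`; on polynomials `h` the sum is finite.  Its defining
property is `D(Φ)e^{⟨ξ,·⟩} = Φ(ξ)e^{⟨ξ,·⟩}`. -/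
def DOp (p : FormalMultilinearSeries ℝ (Vd d) ℝ) (h : Vd d → ℝ) (x : Vd d) : ℝ :=
  ∑ᶠ n : ℕ, multiPair (p n) (iteratedFDeriv ℝ n h x)

/-- `h` is a polynomial function on `ℝ^d`. -/
def IsPolyFun (h : Vd d → ℝ) : Prop :=
  ∃ p : MvPolynomial (Fin d) ℝ, ∀ x : Vd d, h x = MvPolynomial.eval (fun i => x i) p

/-- `h` is a polynomial function of degree at most `r` on `ℝ^d`. -/
def IsPolyFunOfDeg (h : Vd d → ℝ) (r : ℕ) : Prop :=
  ∃ p : MvPolynomial (Fin d) ℝ, p.totalDegree ≤ r ∧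
    ∀ x : Vd d, h x = MvPolynomial.eval (fun i => x i) p

end

noncomputable section
namespace EM
variable {d : ℕ}

/-! ### the pairing -/

theorem pairE_add (ξ x y : Vd d) : pairE ξ (x + y) = pairE ξ x + pairE ξ y := inner_add_right _ _ _
theorem pairE_sub (ξ x y : Vd d) : pairE ξ (x - y) = pairE ξ x - pairE ξ y := inner_sub_right _ _ _
theorem pairE_smul (ξ x : Vd d) (t : ℝ) : pairE ξ (t • x) = t * pairE ξ x := inner_smul_right _ _ _
theorem pairE_neg (ξ x : Vd d) : pairE ξ (-x) = - pairE ξ x := inner_neg_right _ _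
theorem pairE_zero (ξ : Vd d) : pairE ξ 0 = 0 := inner_zero_right _
theorem pairE_sum {β : Type*} (ξ : Vd d) (s : Finset β) (f : β → Vd d) :
    pairE ξ (∑ i ∈ s, f i) = ∑ i ∈ s, pairE ξ (f i) := inner_sum _ _ _
theorem pairE_add_left (ξ η x : Vd d) : pairE (ξ + η) x = pairE ξ x + pairE η x :=
  inner_add_left _ _ _
theorem pairE_smul_left (ξ x : Vd d) (t : ℝ) : pairE (t • ξ) x = t * pairE ξ x :=
  real_inner_smul_left _ _ _
theorem pairE_neg_left (ξ x : Vd d) : pairE (-ξ) x = - pairE ξ x := inner_neg_left _ _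
theorem pairE_zero_left (x : Vd d) : pairE 0 x = 0 := inner_zero_left _
theorem pairE_sum_left {β : Type*} (s : Finset β) (f : β → Vd d) (x : Vd d) :
    pairE (∑ i ∈ s, f i) x = ∑ i ∈ s, pairE (f i) x := sum_inner _ _ _
theorem abs_pairE_le (ξ x : Vd d) : |pairE ξ x| ≤ ‖ξ‖ * ‖x‖ := abs_real_inner_le_norm _ _
theorem continuous_pairE (ξ : Vd d) : Continuous (fun x => pairE ξ x) := by
  unfold pairE; fun_prop
theorem continuous_pairE_left (x : Vd d) : Continuous (fun ξ => pairE ξ x) := by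
  unfold pairE; fun_prop
theorem continuous_exp_pairE (ξ : Vd d) : Continuous (fun x => Real.exp (pairE ξ x)) :=
  Real.continuous_exp.comp (continuous_pairE ξ)

/-! ### translation operators -/

/-- translation operators on functions. -/
def tau : Multiplicative (Vd d) →* Module.End ℝ (Vd d → ℝ) where
  toFun u := LinearMap.funLeft ℝ ℝ (fun x => x - u.toAdd)
  map_one' := by ext f x; simp [LinearMap.funLeft_apply]
  map_mul' u w := by
    ext f x; simp [LinearMap.funLeft_apply, sub_sub]

/-- the action of the group algebra on functions. -/
def act : AddMonoidAlgebra ℝ (Vd d) →ₐ[ℝ] Module.End ℝ (Vd d → ℝ) :=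
  AddMonoidAlgebra.lift ℝ _ _ tau

/-- exponential character. -/
def expo (ξ : Vd d) : Multiplicative (Vd d) →* ℝ where
  toFun u := Real.exp (pairE ξ u.toAdd)
  map_one' := by simp [pairE_zero]
  map_mul' u w := by simp [pairE_add, Real.exp_add]

/-- evaluation of the group algebra at the character `ξ`. -/
def ev (ξ : Vd d) : AddMonoidAlgebra ℝ (Vd d) →ₐ[ℝ] ℝ :=
  AddMonoidAlgebra.lift ℝ _ _ (expo ξ)

/-- the difference element `1 - [u]`. -/
def del (u : Vd d) : AddMonoidAlgebra ℝ (Vd d) := 1 - AddMonoidAlgebra.single u 1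

theorem act_del (u : Vd d) (f : Vd d → ℝ) (x : Vd d) :
    act (del u) f x = f x - f (x - u) := by
  simp [act, del, tau, LinearMap.funLeft_apply]

theorem ev_del (ξ u : Vd d) : ev ξ (del u) = 1 - Real.exp (pairE ξ u) := by
  simp [ev, del, expo]

theorem act_mul_apply (p q : AddMonoidAlgebra ℝ (Vd d)) (f : Vd d → ℝ) :
    act (p * q) f = act p (act q f) := by
  rw [map_mul]; rfl

theorem del_dvd (u : Vd d) (N : ℕ) : del u ∣ del ((N : ℝ) • u) := by
  have : AddMonoidAlgebra.single ((N : ℝ) • u) (1 : ℝ) = (AddMonoidAlgebra.single u 1) ^ N := by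
    rw [AddMonoidAlgebra.single_pow, Nat.cast_smul_eq_nsmul]; simp
  unfold del
  rw [this]
  simpa using sub_dvd_pow_sub_pow (1 : AddMonoidAlgebra ℝ (Vd d)) (AddMonoidAlgebra.single u 1) N

theorem act_prod_local {β : Type*} (s : Finset β) (u : β → Vd d) (f : Vd d → ℝ) (x : Vd d) (R : ℝ)
    (hR : ∑ e ∈ s, ‖u e‖ ≤ R)
    (hf : ∀ y, ‖y - x‖ ≤ R → f y = 0) : act (∏ e ∈ s, del (u e)) f x = 0 := by
  classical
  induction s using Finset.induction_on generalizing x R with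
  | empty =>
    simp only [Finset.prod_empty, map_one]
    exact hf x (by simpa using hR)
  | insert a s ha ih =>
    rw [Finset.prod_insert ha, act_mul_apply, act_del]
    rw [Finset.sum_insert ha] at hR
    rw [ih x R (by linarith [norm_nonneg (u a)]) hf,
      ih (x - u a) (R - ‖u a‖) (by linarith), sub_zero]
    intro y hy
    apply hf
    calc ‖y - x‖ = ‖(y - (x - u a)) + (-(u a))‖ := by congr 1; abel
      _ ≤ ‖y - (x - u a)‖ + ‖-(u a)‖ := norm_add_le _ _
      _ ≤ R := by rw [norm_neg]; linarith

theorem act_prod_congr {β : Type*} (s : Finset β) (u : β → Vd d) (f g : Vd d → ℝ) (x : Vd d) (R : ℝ)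
    (hR : ∑ e ∈ s, ‖u e‖ ≤ R)
    (hf : ∀ y, ‖y - x‖ ≤ R → f y = g y) :
    act (∏ e ∈ s, del (u e)) f x = act (∏ e ∈ s, del (u e)) g x := by
  have := act_prod_local s u (f - g) x R hR (fun y hy => by simp [hf y hy])
  rw [map_sub] at this
  simpa [sub_eq_zero] using this

theorem act_prod_toggle {β : Type*} (s : Finset β) (u : β → Vd d) (f : Vd d → ℝ) (x : Vd d) (R : ℝ)
    (hR : ∑ e ∈ s, ‖u e‖ ≤ R) (a : β) (ha : a ∈ s)
    (hf : ∀ y, ‖y - x‖ ≤ R → f (y - u a) = f y) : act (∏ e ∈ s, del (u e)) f x = 0 := by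
  classical
  rw [← Finset.prod_erase_mul s _ ha, act_mul_apply]
  apply act_prod_local _ _ _ _ R
  · refine le_trans (Finset.sum_le_sum_of_subset_of_nonneg (Finset.erase_subset a s) ?_) hR
    intros; positivity
  · intro y hy
    rw [act_del, hf y hy, sub_self]

theorem act_prod_bdd {β : Type*} (s : Finset β) (u : β → Vd d) (f : Vd d → ℝ) 
    (hf : Measurable f ∧ ∃ C, ∀ x, |f x| ≤ C) :
    Measurable (act (∏ e ∈ s, del (u e)) f) ∧ ∃ C, ∀ x, |act (∏ e ∈ s, del (u e)) f x| ≤ C := by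
  classical
  induction s using Finset.induction_on with
  | empty => simpa using hf
  | insert a s ha ih =>
    rw [Finset.prod_insert ha, act_mul_apply]
    obtain ⟨h1, C, hC⟩ := ih
    have e : act (del (u a)) (act (∏ e ∈ s, del (u e)) f) = fun x =>
      (act (∏ e ∈ s, del (u e)) f) x - (act (∏ e ∈ s, del (u e)) f) (x - u a) := by
      ext x; rw [act_del]
    constructor
    · rw [e]
      exact h1.sub (h1.comp (measurable_id.sub_const _))
    · refine ⟨C + C, fun x => ?_⟩
      rw [e]
      exact (abs_sub _ _).trans (add_le_add (hC _) (hC _))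

theorem int_prod {β : Type*} (s : Finset β) (u : β → Vd d) (f : Vd d → ℝ) (ν : Measure (Vd d))
    (hν : ∀ e ∈ s, MeasurePreserving (fun x => x + u e) ν ν) (ξ : Vd d)
    (hf : Integrable (fun x => f x * Real.exp (pairE ξ x)) ν) :
    Integrable (fun x => act (∏ e ∈ s, del (u e)) f x * Real.exp (pairE ξ x)) ν ∧
    ∫ x, act (∏ e ∈ s, del (u e)) f x * Real.exp (pairE ξ x) ∂ν =
      ev ξ (∏ e ∈ s, del (u e)) * ∫ x, f x * Real.exp (pairE ξ x) ∂ν := by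
  classical
  induction s using Finset.induction_on with
  | empty => simpa using hf
  | insert a s ha ih =>
    rw [Finset.prod_insert ha, act_mul_apply, map_mul, ev_del]
    obtain ⟨h1, h2⟩ := ih (fun e he => hν e (Finset.mem_insert_of_mem he))
    set g := act (∏ e ∈ s, del (u e)) f
    have hp := hν a (Finset.mem_insert_self _ _)
    have hemb : MeasurableEmbedding (fun x : Vd d => x + u a) := measurableEmbedding_addRight _
    have key : ∀ y, g ((y + u a) - u a) * Real.exp (pairE ξ (y + u a))
        = Real.exp (pairE ξ (u a)) * (g y * Real.exp (pairE ξ y)) := by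
      intro y
      rw [add_sub_cancel_right, pairE_add, Real.exp_add]; ring
    have h3 : Integrable (fun x => g (x - u a) * Real.exp (pairE ξ x)) ν := by
      rw [← hp.integrable_comp_emb hemb]
      have : ((fun x => g (x - u a) * Real.exp (pairE ξ x)) ∘ fun x => x + u a)
        = fun y => Real.exp (pairE ξ (u a)) * (g y * Real.exp (pairE ξ y)) := by
        ext y; exact key y
      rw [this]; exact h1.const_mul _
    have h4 : ∫ x, g (x - u a) * Real.exp (pairE ξ x) ∂ν
        = Real.exp (pairE ξ (u a)) * ∫ x, g x * Real.exp (pairE ξ x) ∂ν := by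
      rw [← hp.integral_comp hemb, ← integral_const_mul]
      exact integral_congr_ae (Eventually.of_forall key)
    have e : (fun x => act (del (u a)) g x * Real.exp (pairE ξ x)) = fun x =>
      g x * Real.exp (pairE ξ x) - g (x - u a) * Real.exp (pairE ξ x) := by
      ext x; rw [act_del]; ring
    rw [e]
    refine ⟨h1.sub h3, ?_⟩
    rw [integral_sub h1 h3, h4, h2]; ring

end EM
end

noncomputable section
namespace EM
variable {d : ℕ}

/-! ### polyhedra given by inequalities -/

/-- the polyhedron given by inequalities. -/
def HP {ι : Type*} (φ : ι → Vd d) (c : ι → ℝ) : Set (Vd d) := {x | ∀ i, pairE (φ i) x ≤ c i}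

/-- the cone at `v` generated by `F`. -/
def KC (v : Vd d) (F : Set (Vd d)) : Set (Vd d) := {z | ∃ t : ℝ, 0 < t ∧ v + t • (z - v) ∈ F}

variable {ι : Type*} {φ : ι → Vd d} {c : ι → ℝ}

theorem HP_closed : IsClosed (HP φ c) := by
  unfold HP
  simp only [Set.ofPred_forall]
  exact isClosed_iInter fun i => isClosed_le (continuous_pairE _) continuous_const

theorem HP_convex : Convex ℝ (HP φ c) := by
  intro x hx y hy a b ha hb hab i
  rw [pairE_add, pairE_smul, pairE_smul]
  calc _ ≤ a * c i + b * c i := add_le_add (mul_le_mul_of_nonneg_left (hx i) ha)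
        (mul_le_mul_of_nonneg_left (hy i) hb)
    _ = c i := by rw [← add_mul, hab, one_mul]

variable [Finite ι]

theorem small_t {v u : Vd d} (hv : v ∈ HP φ c) (hu : ∀ i, pairE (φ i) v = c i → pairE (φ i) u ≤ 0) :
    ∀ᶠ t : ℝ in 𝓝[>] 0, v + t • u ∈ HP φ c := by
  unfold HP
  simp only [Set.mem_ofPred_eq]
  rw [eventually_all]
  intro i
  rcases (hv i).lt_or_eq with h | h
  · have : Tendsto (fun t : ℝ => pairE (φ i) (v + t • u)) (𝓝[>] 0) (𝓝 (pairE (φ i) v)) := by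
      have h0 : Continuous (fun t : ℝ => pairE (φ i) (v + t • u)) :=
        (continuous_pairE _).comp (by fun_prop)
      have := h0.tendsto 0
      simp only [zero_smul, add_zero] at this
      exact this.mono_left nhdsWithin_le_nhds
    filter_upwards [this.eventually (gt_mem_nhds h)] with t ht using ht.le
  · filter_upwards [self_mem_nhdsWithin] with t ht
    rw [pairE_add, pairE_smul, h]
    have := mul_nonpos_of_nonneg_of_nonpos (le_of_lt ht) (hu i h)
    linarith

theorem KC_HP {v : Vd d} (hv : v ∈ HP φ c) :
    KC v (HP φ c) = {x | ∀ i, pairE (φ i) v = c i → pairE (φ i) x ≤ c i} := by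
  ext z
  constructor
  · rintro ⟨t, ht, h⟩ i hi
    have := h i
    rw [pairE_add, pairE_smul, pairE_sub, hi] at this
    by_contra! hc
    nlinarith
  · intro h
    have := small_t (u := z - v) hv (fun i hi => by
      rw [pairE_sub, hi]; linarith [h i hi])
    obtain ⟨t, h1, h2⟩ := (this.and self_mem_nhdsWithin).exists
    exact ⟨t, h2, h1⟩

theorem KC_HP' {v : Vd d} (hv : v ∈ HP φ c) :
    KC v (HP φ c) = HP (fun i : {i // pairE (φ i) v = c i} => φ i) (fun i => c i) := by
  rw [KC_HP hv]; ext x; simp [HP]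

theorem ext_ker {v u : Vd d} (hv : v ∈ extremePoints ℝ (HP φ c))
    (hu : ∀ i, pairE (φ i) v = c i → pairE (φ i) u = 0) : u = 0 := by
  have h1 := small_t (u := u) hv.1 (fun i hi => (hu i hi).le)
  have h2 := small_t (u := -u) hv.1 (fun i hi => by rw [pairE_neg, hu i hi]; simp)
  obtain ⟨t, ⟨h1, h2⟩, ht⟩ := ((h1.and h2).and self_mem_nhdsWithin).exists
  have ht : 0 < t := ht
  have := hv.2 h1 h2 ⟨1/2, 1/2, by norm_num, by norm_num, by norm_num, by module⟩
  have : t • u = 0 := by simpa using this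
  rcases smul_eq_zero.mp this with h | h
  · exact absurd h ht.ne'
  · exact h

theorem ext_finite : (extremePoints ℝ (HP φ c)).Finite := by
  have : Set.InjOn (fun v => {i | pairE (φ i) v = c i}) (extremePoints ℝ (HP φ c)) := by
    intro v hv w hw h
    have := ext_ker (u := w - v) hv (fun i hi => by
      have hw : i ∈ {i | pairE (φ i) w = c i} := by
        have : {i | pairE (φ i) v = c i} = {i | pairE (φ i) w = c i} := h
        rw [← this]; exact hi
      have hw : pairE (φ i) w = c i := hw
      rw [pairE_sub, hi, hw, sub_self])
    exact (sub_eq_zero.mp this).symm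
  exact Set.Finite.of_finite_image (Set.toFinite _) this

theorem HP_hull (hb : Bornology.IsBounded (HP φ c)) :
    convexHull ℝ (extremePoints ℝ (HP φ c)) = HP φ c := by
  have hc : IsCompact (HP φ c) := Metric.isCompact_of_isClosed_isBounded HP_closed hb
  have := closure_convexHull_extremePoints hc HP_convex
  rwa [((ext_finite (φ := φ) (c := c)).isCompact_convexHull (𝕜 := ℝ)).isClosed.closure_eq] at this

/-- the finset of vertices. -/
def Vx (φ : ι → Vd d) (c : ι → ℝ) : Finset (Vd d) := (ext_finite (φ := φ) (c := c)).toFinset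

theorem mem_Vx {v : Vd d} : v ∈ Vx φ c ↔ v ∈ extremePoints ℝ (HP φ c) := by simp [Vx]

theorem HP_comb (hb : Bornology.IsBounded (HP φ c)) {y : Vd d} (hy : y ∈ HP φ c) :
    ∃ t : Vd d → ℝ, (∀ v ∈ Vx φ c, 0 ≤ t v) ∧ ∑ v ∈ Vx φ c, t v = 1 ∧
      ∑ v ∈ Vx φ c, t v • v = y := by
  have : y ∈ convexHull ℝ ((Vx φ c : Finset (Vd d)) : Set (Vd d)) := by
    rw [Vx, Set.Finite.coe_toFinset, HP_hull hb]; exact hy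
  rw [Finset.mem_convexHull'] at this
  exact this

theorem KC_comb (hb : Bornology.IsBounded (HP φ c)) {v z : Vd d} (hz : z ∈ KC v (HP φ c)) :
    ∃ s : Vd d → ℝ, (∀ w ∈ Vx φ c, 0 ≤ s w) ∧ z = v + ∑ w ∈ Vx φ c, s w • (w - v) := by
  obtain ⟨t, ht, h⟩ := hz
  obtain ⟨r, hr, hr1, hr2⟩ := HP_comb hb h
  refine ⟨fun w => t⁻¹ * r w, fun w hw => mul_nonneg (inv_nonneg.mpr ht.le) (hr w hw), ?_⟩
  have : ∑ w ∈ Vx φ c, r w • (w - v) = t • (z - v) := by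
    simp_rw [smul_sub, Finset.sum_sub_distrib]
    rw [← Finset.sum_smul, hr1, hr2]; simp [smul_sub]
  simp_rw [mul_smul]
  rw [← Finset.smul_sum, this, smul_smul, inv_mul_cancel₀ ht.ne']; simp

theorem KC_of_comb {v : Vd d} (hv : v ∈ HP φ c) (s : Vd d → ℝ) (hs : ∀ w ∈ Vx φ c, 0 ≤ s w) :
    v + ∑ w ∈ Vx φ c, s w • (w - v) ∈ KC v (HP φ c) := by
  rw [KC_HP hv]
  intro i hi
  rw [pairE_add, hi, pairE_sum]
  have : ∑ w ∈ Vx φ c, pairE (φ i) (s w • (w - v)) ≤ 0 := by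
    apply Finset.sum_nonpos
    intro w hw
    rw [pairE_smul, pairE_sub, hi]
    apply mul_nonpos_of_nonneg_of_nonpos (hs w hw)
    linarith [(mem_Vx.mp hw).1 i]
  linarith

theorem KC_no_line {v : Vd d} (hv : v ∈ Vx φ c) : ¬ ContainsLine (KC v (HP φ c)) := by
  rintro ⟨x, u, hu, h⟩
  rw [mem_Vx] at hv
  rw [KC_HP hv.1] at h
  apply hu
  apply ext_ker hv
  intro i hi
  by_contra hne
  have h1 := h ((c i - pairE (φ i) x + 1) / pairE (φ i) u) i hi
  rw [pairE_add, pairE_smul, div_mul_cancel₀ _ hne] at h1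
  linarith

/-- a functional that is negative on all the other generators of the vertex cone. -/
theorem exists_neg {v : Vd d} (hv : v ∈ Vx φ c) :
    ∃ ξ : Vd d, ∀ w ∈ Vx φ c, w ≠ v → pairE ξ (w - v) < 0 := by
  classical
  have := Fintype.ofFinite ι
  refine ⟨∑ i ∈ Finset.univ.filter (fun i => pairE (φ i) v = c i), φ i, fun w hw hne => ?_⟩
  rw [pairE_sum_left]
  have hle : ∀ i ∈ Finset.univ.filter (fun i => pairE (φ i) v = c i), pairE (φ i) (w - v) ≤ 0 := by
    intro i hi
    have hi : pairE (φ i) v = c i := by simpa using hi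
    rw [pairE_sub, hi]
    linarith [(mem_Vx.mp hw).1 i]
  rcases (Finset.sum_nonpos hle).lt_or_eq with h | h
  · exact h
  · exfalso
    rw [Finset.sum_eq_zero_iff_of_nonpos hle] at h
    apply hne
    have := ext_ker (u := w - v) (mem_Vx.mp hv) (fun i hi => h i (by simpa using hi))
    exact sub_eq_zero.mp this

end EM
end

noncomputable section
namespace EM
variable {d : ℕ}

/-! ### Brion's theorem for indicator functions -/

open Classical in
/-- product of differences along all (scaled) pairs of vertices. -/
def dU (X : Finset (Vd d)) (ε : ℝ) : AddMonoidAlgebra ℝ (Vd d) :=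
  ∏ p ∈ X.offDiag, del (ε • (p.2 - p.1))

/-- total size of the differences. -/
def R1 (X : Finset (Vd d)) : ℝ := ∑ v ∈ X, ∑ w ∈ X, ‖w - v‖

theorem R1_nonneg (X : Finset (Vd d)) : 0 ≤ R1 X := by unfold R1; positivity

theorem R1_row {X : Finset (Vd d)} {v : Vd d} (hv : v ∈ X) : ∑ w ∈ X, ‖w - v‖ ≤ R1 X := by
  unfold R1
  exact Finset.single_le_sum (f := fun v => ∑ w ∈ X, ‖w - v‖)
    (fun i _ => Finset.sum_nonneg fun _ _ => norm_nonneg _) hv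

open Classical in
theorem R1_sum (X : Finset (Vd d)) {ε : ℝ} (hε : 0 ≤ ε) :
    ∑ p ∈ X.offDiag, ‖ε • (p.2 - p.1)‖ ≤ ε * R1 X := by
  unfold R1
  rw [← Finset.sum_product', Finset.mul_sum]
  refine (Finset.sum_le_sum_of_subset_of_nonneg (t := X ×ˢ X) ?_ ?_).trans ?_
  · intro p hp; simp at hp ⊢; tauto
  · intros; positivity
  · apply le_of_eq
    apply Finset.sum_congr rfl
    intro p _
    rw [norm_smul, Real.norm_of_nonneg hε]

/-- indicator function. -/
def ind (F : Set (Vd d)) : Vd d → ℝ := F.indicator (fun _ => (1 : ℝ))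

theorem ind_congr {F G : Set (Vd d)} {x y : Vd d} (h : x ∈ F ↔ y ∈ G) : ind F x = ind G y := by
  classical
  simp only [ind, Set.indicator_apply, h]

theorem ind_zero {F : Set (Vd d)} {x : Vd d} (h : x ∉ F) : ind F x = 0 := by
  simp [ind, h]

variable {ι : Type*} {φ : ι → Vd d} {c : ι → ℝ}

theorem toggle_HP (X : Finset (Vd d)) {ε : ℝ} (hε : 0 ≤ ε) {x y : Vd d}
    (hyx : ‖y - x‖ ≤ ε * R1 X) {v w : Vd d} (hv : v ∈ X) (hw : w ∈ X) (hvw : v ≠ w)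
    (hs : ∀ i, pairE (φ i) (w - v) = 0 ∨ pairE (φ i) y + 3 * (ε * R1 X) * ‖φ i‖ ≤ c i) :
    act (dU X ε) (ind (HP φ c)) x = 0 := by
  classical
  unfold dU
  refine act_prod_toggle _ _ _ _ _ (R1_sum X hε) (v, w) (by simp [hv, hw, hvw]) ?_
  intro z hz
  have hR := mul_nonneg hε (R1_nonneg X)
  have hzy : ‖z - y‖ ≤ 2 * (ε * R1 X) := by
    calc ‖z - y‖ = ‖(z - x) - (y - x)‖ := by congr 1; abel
      _ ≤ ‖z - x‖ + ‖y - x‖ := norm_sub_le _ _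
      _ ≤ _ := by linarith
  have hu : ‖ε • (w - v)‖ ≤ ε * R1 X := by
    rw [norm_smul, Real.norm_of_nonneg hε]
    apply mul_le_mul_of_nonneg_left _ hε
    refine le_trans ?_ (R1_row hv)
    exact Finset.single_le_sum (f := fun w => ‖w - v‖) (fun _ _ => norm_nonneg _) hw
  apply ind_congr
  apply forall_congr'
  intro i
  rcases hs i with h | h
  · simp only [pairE_sub, pairE_smul] at h ⊢
    rw [h]; simp
  · have h0 := norm_nonneg (φ i)
    have h1 := (abs_le.mp (abs_pairE_le (φ i) (z - y))).2
    have h2 := (abs_le.mp (abs_pairE_le (φ i) (ε • (w - v)))).1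
    have h3 := mul_le_mul_of_nonneg_left hzy h0
    have h4 := mul_le_mul_of_nonneg_left hu h0
    have h5 := mul_nonneg h0 hR
    rw [pairE_sub] at h1
    constructor
    · intro; linarith
    · intro; simp only [pairE_sub]; linarith

variable [Finite ι]

theorem exists_kappa (φ : ι → Vd d) (c : ι → ℝ) :
    ∃ κ : ℝ, 0 < κ ∧ ∀ i, ∀ w ∈ Vx φ c, pairE (φ i) w = c i ∨
      3 * R1 (Vx φ c) * ‖φ i‖ ≤ κ * (c i - pairE (φ i) w) := by
  have : ∀ᶠ κ : ℝ in atTop, ∀ i, ∀ w ∈ Vx φ c, pairE (φ i) w = c i ∨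
      3 * R1 (Vx φ c) * ‖φ i‖ ≤ κ * (c i - pairE (φ i) w) := by
    rw [eventually_all]
    intro i
    rw [Finset.eventually_all]
    intro w hw
    rcases ((mem_Vx.mp hw).1 i).lt_or_eq with h | h
    · have : Tendsto (fun κ : ℝ => κ * (c i - pairE (φ i) w)) atTop atTop :=
        tendsto_id.atTop_mul_const (by linarith)
      filter_upwards [this.eventually_ge_atTop (3 * R1 (Vx φ c) * ‖φ i‖)] with κ hκ using Or.inr hκ
    · exact Eventually.of_forall fun _ => Or.inl h
  obtain ⟨κ, h1, h2⟩ := (this.and (eventually_gt_atTop 0)).exists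
  exact ⟨κ, h2, h1⟩

theorem norm_comb_le {X : Finset (Vd d)} {v : Vd d} (hv : v ∈ X) (s : Vd d → ℝ) (δ : ℝ)
    (hs0 : ∀ w ∈ X, 0 ≤ s w) (hs : ∀ w ∈ X, w ≠ v → s w ≤ δ) (hδ : 0 ≤ δ) :
    ‖∑ w ∈ X, s w • (w - v)‖ ≤ δ * R1 X := by
  refine (norm_sum_le _ _).trans ?_
  refine le_trans ?_ (mul_le_mul_of_nonneg_left (R1_row hv) hδ)
  rw [Finset.mul_sum]
  apply Finset.sum_le_sum
  intro w hw
  by_cases h : w = v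
  · simp [h]
  · rw [norm_smul, Real.norm_of_nonneg (hs0 w hw)]
    exact mul_le_mul_of_nonneg_right (hs w hw h) (norm_nonneg _)

theorem lemA (hb : Bornology.IsBounded (HP φ c)) {κ : ℝ} (hκ : 0 < κ)
    (hk : ∀ i, ∀ w ∈ Vx φ c, pairE (φ i) w = c i ∨
      3 * R1 (Vx φ c) * ‖φ i‖ ≤ κ * (c i - pairE (φ i) w))
    {v : Vd d} (hv : v ∈ Vx φ c) {ε : ℝ} (hε : 0 < ε) (x : Vd d)
    (hx : act (dU (Vx φ c) ε) (ind (KC v (HP φ c))) x ≠ 0) :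
    ‖x - v‖ ≤ ε * ((κ + 1) * R1 (Vx φ c)) := by
  classical
  set X := Vx φ c
  have hvP := (mem_Vx.mp hv).1
  by_cases hy : ∃ y, ‖y - x‖ ≤ ε * R1 X ∧ y ∈ KC v (HP φ c)
  · obtain ⟨y, hyx, hy⟩ := hy
    obtain ⟨s, hs0, hs⟩ := KC_comb hb hy
    by_cases hbig : ∃ w ∈ X, w ≠ v ∧ ε * κ ≤ s w
    · exfalso; apply hx
      obtain ⟨w, hw, hwv, hsw⟩ := hbig
      rw [KC_HP' hvP]
      refine toggle_HP X hε.le hyx hv hw hwv.symm ?_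
      rintro ⟨i, hi⟩
      simp only
      rcases hk i w hw with h | h
      · left; rw [pairE_sub, h, hi, sub_self]
      · right
        have e : pairE (φ i) y = c i - ∑ w ∈ X, s w * (c i - pairE (φ i) w) := by
          rw [hs, pairE_add, hi, pairE_sum, sub_eq_add_neg, ← Finset.sum_neg_distrib]
          congr 1
          apply Finset.sum_congr rfl
          intro w _
          rw [pairE_smul, pairE_sub, hi]; ring
        have h1 : s w * (c i - pairE (φ i) w) ≤ ∑ w ∈ X, s w * (c i - pairE (φ i) w) :=
          Finset.single_le_sum (f := fun w => s w * (c i - pairE (φ i) w))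
            (fun w hw => mul_nonneg (hs0 w hw) (by linarith [(mem_Vx.mp hw).1 i])) hw
        have h2 : ε * κ * (c i - pairE (φ i) w) ≤ s w * (c i - pairE (φ i) w) :=
          mul_le_mul_of_nonneg_right hsw (by linarith [(mem_Vx.mp hw).1 i])
        have h3 := mul_le_mul_of_nonneg_left h hε.le
        rw [e]; nlinarith
    · push Not at hbig
      have := norm_comb_le hv s (ε * κ) hs0 (fun w hw hwv => (hbig w hw hwv).le) (by positivity)
      have e : y - v = ∑ w ∈ X, s w • (w - v) := by rw [hs, add_sub_cancel_left]
      rw [← e] at this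
      calc ‖x - v‖ = ‖(y - v) - (y - x)‖ := by congr 1; abel
        _ ≤ ‖y - v‖ + ‖y - x‖ := norm_sub_le _ _
        _ ≤ _ := by linarith
  · exfalso; apply hx
    push Not at hy
    exact act_prod_local _ _ _ _ _ (R1_sum X hε.le) (fun y h => ind_zero (hy y h))

theorem lemB (hb : Bornology.IsBounded (HP φ c)) {κ : ℝ} (hκ : 0 < κ)
    (hk : ∀ i, ∀ w ∈ Vx φ c, pairE (φ i) w = c i ∨
      3 * R1 (Vx φ c) * ‖φ i‖ ≤ κ * (c i - pairE (φ i) w))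
    {ε : ℝ} (hε : 0 < ε) (hε1 : ε * κ * (Vx φ c).card < 1) (x : Vd d)
    (hx : act (dU (Vx φ c) ε) (ind (HP φ c)) x ≠ 0) :
    ∃ v ∈ Vx φ c, ‖x - v‖ ≤ ε * ((κ + 1) * R1 (Vx φ c)) := by
  classical
  set X := Vx φ c
  by_cases hy : ∃ y, ‖y - x‖ ≤ ε * R1 X ∧ y ∈ HP φ c
  · obtain ⟨y, hyx, hy⟩ := hy
    obtain ⟨t, ht0, ht1, hty⟩ := HP_comb hb hy
    obtain ⟨v, hv, htv⟩ : ∃ v ∈ X, ε * κ ≤ t v := by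
      by_contra! hcon
      have : ∑ v ∈ X, t v ≤ ∑ v ∈ X, ε * κ := Finset.sum_le_sum fun v hv => (hcon v hv).le
      rw [Finset.sum_const, nsmul_eq_mul] at this
      linarith
    refine ⟨v, hv, ?_⟩
    by_cases hbig : ∃ w ∈ X, w ≠ v ∧ ε * κ ≤ t w
    · exfalso; apply hx
      obtain ⟨w, hw, hwv, htw⟩ := hbig
      refine toggle_HP X hε.le hyx hv hw hwv.symm ?_
      intro i
      have e : pairE (φ i) y = c i - ∑ w ∈ X, t w * (c i - pairE (φ i) w) := by
        rw [← hty, pairE_sum]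
        simp_rw [mul_sub, pairE_smul]
        rw [Finset.sum_sub_distrib, ← Finset.sum_mul, ht1]; ring
      have key : ∀ w ∈ X, ε * κ ≤ t w → 3 * R1 X * ‖φ i‖ ≤ κ * (c i - pairE (φ i) w) →
          pairE (φ i) y + 3 * (ε * R1 X) * ‖φ i‖ ≤ c i := by
        intro w hw hsw h
        have h1 : t w * (c i - pairE (φ i) w) ≤ ∑ w ∈ X, t w * (c i - pairE (φ i) w) :=
          Finset.single_le_sum (f := fun w => t w * (c i - pairE (φ i) w))
            (fun w hw => mul_nonneg (ht0 w hw) (by linarith [(mem_Vx.mp hw).1 i])) hw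
        have h2 : ε * κ * (c i - pairE (φ i) w) ≤ t w * (c i - pairE (φ i) w) :=
          mul_le_mul_of_nonneg_right hsw (by linarith [(mem_Vx.mp hw).1 i])
        have h3 := mul_le_mul_of_nonneg_left h hε.le
        rw [e]; nlinarith
      rcases hk i v hv with h | h
      · rcases hk i w hw with h' | h'
        · left; rw [pairE_sub, h, h', sub_self]
        · exact Or.inr (key w hw htw h')
      · exact Or.inr (key v hv htv h)
    · push Not at hbig
      have := norm_comb_le hv t (ε * κ) ht0 (fun w hw hwv => (hbig w hw hwv).le) (by positivity)
      have e : y - v = ∑ w ∈ X, t w • (w - v) := by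
        simp_rw [smul_sub]
        rw [Finset.sum_sub_distrib, ← Finset.sum_smul, ht1, hty, one_smul]
      rw [← e] at this
      calc ‖x - v‖ = ‖(y - v) - (y - x)‖ := by congr 1; abel
        _ ≤ ‖y - v‖ + ‖y - x‖ := norm_sub_le _ _
        _ ≤ _ := by linarith
  · exfalso; apply hx
    push Not at hy
    exact act_prod_local _ _ _ _ _ (R1_sum X hε.le) (fun y h => ind_zero (hy y h))

theorem lemC {v : Vd d} (hv : v ∈ Vx φ c) {ε ρ : ℝ} (hε : 0 < ε)
    (hs : ∀ i, pairE (φ i) v = c i ∨ ‖φ i‖ * (ε * (ρ + R1 (Vx φ c))) ≤ c i - pairE (φ i) v)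
    (x : Vd d) (hx : ‖x - v‖ ≤ ε * ρ) :
    act (dU (Vx φ c) ε) (ind (HP φ c)) x = act (dU (Vx φ c) ε) (ind (KC v (HP φ c))) x := by
  apply act_prod_congr _ _ _ _ _ _ (R1_sum (Vx φ c) hε.le)
  intro y hy
  apply ind_congr
  rw [KC_HP (mem_Vx.mp hv).1]
  constructor
  · intro h i _; exact h i
  · intro h i
    rcases hs i with h1 | h1
    · exact h i h1
    · have h2 : ‖y - v‖ ≤ ε * (ρ + R1 (Vx φ c)) := by
        calc ‖y - v‖ = ‖(y - x) + (x - v)‖ := by congr 1; abel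
          _ ≤ ‖y - x‖ + ‖x - v‖ := norm_add_le _ _
          _ ≤ _ := by linarith
      have h3 := (abs_le.mp (abs_pairE_le (φ i) (y - v))).2
      have h4 := mul_le_mul_of_nonneg_left h2 (norm_nonneg (φ i))
      rw [pairE_sub] at h3
      linarith

theorem brion_small (hb : Bornology.IsBounded (HP φ c)) :
    ∀ᶠ ε : ℝ in 𝓝[>] 0,
      act (dU (Vx φ c) ε) (ind (HP φ c) - ∑ v ∈ Vx φ c, ind (KC v (HP φ c))) = 0 := by
  classical
  obtain ⟨κ, hκ, hk⟩ := exists_kappa φ c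
  set X := Vx φ c with hX
  set ρ := (κ + 1) * R1 X with hρ
  have small : ∀ a b : ℝ, 0 < b → ∀ᶠ ε : ℝ in 𝓝[>] 0, ε * a < b := by
    intro a b hb
    have h0 : Continuous (fun t : ℝ => t * a) := by fun_prop
    have := h0.tendsto 0
    simp only [zero_mul] at this
    exact (this.mono_left nhdsWithin_le_nhds).eventually (gt_mem_nhds hb)
  have e1 := small (κ * X.card) 1 one_pos
  have e2 : ∀ᶠ ε : ℝ in 𝓝[>] 0, ∀ v ∈ X, ∀ i, pairE (φ i) v = c i ∨
      ‖φ i‖ * (ε * (ρ + R1 X)) ≤ c i - pairE (φ i) v := by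
    rw [Finset.eventually_all]
    intro v hv
    rw [eventually_all]
    intro i
    rcases ((mem_Vx.mp hv).1 i).lt_or_eq with h | h
    · filter_upwards [small (‖φ i‖ * (ρ + R1 X)) (c i - pairE (φ i) v) (by linarith)] with ε hε
      right; linarith
    · exact Eventually.of_forall fun _ => Or.inl h
  have e3 : ∀ᶠ ε : ℝ in 𝓝[>] 0, ∀ v ∈ X, ∀ w ∈ X, v ≠ w → ε * (2 * ρ) < ‖v - w‖ := by
    rw [Finset.eventually_all]
    intro v hv
    rw [Finset.eventually_all]
    intro w hw
    by_cases h : v = w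
    · exact Eventually.of_forall fun _ h' => absurd h h'
    · filter_upwards [small (2 * ρ) ‖v - w‖ (norm_pos_iff.mpr (sub_ne_zero.mpr h))] with ε hε _
        using hε
  filter_upwards [e1, e2, e3, self_mem_nhdsWithin] with ε e1 e2 e3 hε
  have hε : 0 < ε := hε
  ext x
  rw [map_sub, map_sum]
  simp only [Pi.sub_apply, Finset.sum_apply, Pi.zero_apply]
  by_cases hx : ∃ v ∈ X, ‖x - v‖ ≤ ε * ρ
  · obtain ⟨v, hv, hxv⟩ := hx
    rw [lemC hv hε (e2 v hv) x hxv, Finset.sum_eq_single_of_mem v hv, sub_self]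
    intro w hw hwv
    by_contra hne
    have h1 := lemA hb hκ hk hw hε x hne
    have h2 := e3 v hv w hw hwv.symm
    have h3 : ‖v - w‖ ≤ ‖x - w‖ + ‖x - v‖ := by
      calc ‖v - w‖ = ‖(x - w) - (x - v)‖ := by congr 1; abel
        _ ≤ _ := norm_sub_le _ _
    linarith
  · rw [Finset.sum_eq_zero, sub_zero]
    · by_contra hne
      exact hx (lemB hb hκ hk hε (by rw [mul_assoc]; exact e1) x hne)
    · intro v hv
      by_contra hne
      exact hx ⟨v, hv, lemA hb hκ hk hv hε x hne⟩

theorem brion_ind (hb : Bornology.IsBounded (HP φ c)) (N : ℕ) :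
    act (dU (Vx φ c) N) (ind (HP φ c) - ∑ v ∈ Vx φ c, ind (KC v (HP φ c))) = 0 := by
  classical
  have h := brion_small hb
  have ht : Tendsto (fun n : ℕ => 1 / ((n : ℝ) + 1)) atTop (𝓝[>] 0) :=
    tendsto_nhdsWithin_iff.mpr ⟨tendsto_one_div_add_atTop_nhds_zero_nat,
      Eventually.of_forall fun n => by
        have : (0:ℝ) < 1 / ((n : ℝ) + 1) := by positivity
        exact this⟩
  obtain ⟨n, hn⟩ := (ht.eventually h).exists
  have hd : dU (Vx φ c) (1 / ((n : ℝ) + 1)) ∣ dU (Vx φ c) N := by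
    unfold dU
    apply Finset.prod_dvd_prod_of_dvd
    intro p _
    have := del_dvd ((1 / ((n : ℝ) + 1)) • (p.2 - p.1)) (N * (n + 1))
    rw [smul_smul] at this
    convert this using 3
    push_cast
    field_simp
  obtain ⟨q, hq⟩ := hd
  rw [hq, mul_comm, act_mul_apply, hn, map_zero]

end EM
end

noncomputable section
namespace EM
variable {d : ℕ}

/-! ### Laplace transforms of compactly supported functions -/

/-- the measure is finite on bounded sets. -/
def FB (ν : Measure (Vd d)) : Prop := ∀ R : ℝ, ν (Metric.closedBall 0 R) < ⊤

/-- bounded measurable function with bounded support. -/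
def Nice (g : Vd d → ℝ) (R : ℝ) : Prop :=
  Measurable g ∧ (∃ C, ∀ x, |g x| ≤ C) ∧ ∀ x, x ∉ Metric.closedBall (0 : Vd d) R → g x = 0

/-- the restriction of the pairing to a ball. -/
def ell (R : ℝ) : Vd d →ₗ[ℝ] C(Metric.closedBall (0 : Vd d) R, ℝ) where
  toFun ξ := ⟨fun x => pairE ξ x, (continuous_pairE ξ).comp continuous_subtype_val⟩
  map_add' ξ η := by ext x; simp [pairE_add_left]
  map_smul' t ξ := by ext x; simp [pairE_smul_left]

theorem ell_apply (R : ℝ) (ξ : Vd d) (x) : ell R ξ x = pairE ξ x := rfl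

theorem exp_apply_C {K : Type*} [TopologicalSpace K] [CompactSpace K] (f : C(K, ℝ)) (x : K) :
    (NormedSpace.exp f) x = Real.exp (f x) := by
  have h1 := NormedSpace.exp_series_hasSum_exp' (𝕂 := ℝ) f
  have h2 := h1.map (ContinuousMap.evalCLM ℝ x) (ContinuousMap.evalCLM ℝ x).continuous
  have h3 := NormedSpace.exp_series_hasSum_exp' (𝕂 := ℝ) (f x)
  rw [Real.exp_eq_exp_ℝ]
  exact h2.unique (by simpa [Function.comp_def] using h3)

theorem exists_L {ν : Measure (Vd d)} (hν : FB ν) {g : Vd d → ℝ} {R : ℝ} (hg : Nice g R) :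
    ∃ L : C(Metric.closedBall (0 : Vd d) R, ℝ) →L[ℝ] ℝ, ∀ F : Vd d → ℝ, ∀ 
      f : C(Metric.closedBall (0 : Vd d) R, ℝ), (∀ x, f x = F x) → L f = ∫ x, g x * F x ∂ν := by
  obtain ⟨hm, ⟨C, hC⟩, hs⟩ := hg
  set K := Metric.closedBall (0 : Vd d) R
  have hK : MeasurableSet K := Metric.isClosed_closedBall.measurableSet
  set m : Measure K := ν.comap Subtype.val
  have : IsFiniteMeasure m := by
    constructor
    rw [Measure.comap_apply _ Subtype.val_injective (fun s hs => MeasurableSet.subtype_image hK hs) _ MeasurableSet.univ]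
    simpa using hν R
  have hitg : ∀ f : C(K, ℝ), Integrable (fun x : K => g x * f x) m := by
    intro f
    refine Integrable.bdd_mul (c := C) ?_ ?_ ?_
    · exact Integrable.of_bound f.continuous.aestronglyMeasurable ‖f‖
        (Eventually.of_forall fun x => f.norm_coe_le_norm x)
    · exact (hm.comp measurable_subtype_coe).aestronglyMeasurable
    · exact Eventually.of_forall fun x => hC _
  let L0 : C(K, ℝ) →ₗ[ℝ] ℝ :=
    { toFun := fun f => ∫ x : K, g x * f x ∂m
      map_add' := fun f1 f2 => by
        rw [← integral_add (hitg f1) (hitg f2)]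
        congr 1; ext x; simp [mul_add]
      map_smul' := fun t f => by
        simp only [RingHom.id_apply, smul_eq_mul]
        rw [← integral_const_mul]
        congr 1; ext x; simp; ring }
  refine ⟨L0.mkContinuous (C * m.real univ) ?_, ?_⟩
  · intro f
    have := norm_integral_le_of_norm_le_const (μ := m) (f := fun x : K => g x * f x) (C := C * ‖f‖)
      (Eventually.of_forall fun x => by
        rw [norm_mul]
        exact mul_le_mul (hC _) (f.norm_coe_le_norm x) (norm_nonneg _) ((abs_nonneg _).trans (hC 0)))
    calc ‖L0 f‖ ≤ C * ‖f‖ * m.real univ := this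
      _ = _ := by ring
  · intro F f hf
    show ∫ x : K, g x * f x ∂m = _
    simp_rw [hf]
    rw [integral_subtype_comap hK (fun x => g x * F x)]
    apply setIntegral_eq_integral_of_forall_compl_eq_zero
    intro x hx
    rw [hs x hx, zero_mul]

/-- the Laplace transform. -/
def lap (ν : Measure (Vd d)) (g : Vd d → ℝ) (ξ : Vd d) : ℝ := ∫ x, g x * Real.exp (pairE ξ x) ∂ν

theorem lap_analytic {ν : Measure (Vd d)} (hν : FB ν) {g : Vd d → ℝ} {R : ℝ} (hg : Nice g R)
    (ξ : Vd d) : AnalyticAt ℝ (lap ν g) ξ := by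
  obtain ⟨L, hL⟩ := exists_L hν hg
  have : lap ν g = fun ξ => L (NormedSpace.exp ((LinearMap.toContinuousLinearMap (ell R)) ξ)) := by
    ext ξ
    rw [hL (fun x => Real.exp (pairE ξ x))]
    · rfl
    · intro x; rw [exp_apply_C]; rfl
  rw [this]
  exact (L.analyticAt _).comp ((NormedSpace.exp_analytic (𝕂 := ℝ) _).comp
    ((LinearMap.toContinuousLinearMap (ell R)).analyticAt _))

theorem lap_hasSum {ν : Measure (Vd d)} (hν : FB ν) {g : Vd d → ℝ} {R : ℝ} (hg : Nice g R)
    (ζ : Vd d) (s : ℝ) :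
    HasSum (fun k : ℕ => ((k.factorial : ℝ)⁻¹ * ∫ x, g x * (pairE ζ x) ^ k ∂ν) * s ^ k)
      (lap ν g (s • ζ)) := by
  obtain ⟨L, hL⟩ := exists_L hν hg
  have h1 := NormedSpace.exp_series_hasSum_exp' (𝕂 := ℝ) (ell R (s • ζ))
  have h2 := h1.map L L.continuous
  rw [hL (fun x => Real.exp (pairE (s • ζ) x)) _ (fun x => by rw [exp_apply_C]; rfl)] at h2
  refine h2.congr_fun ?_ |> fun h => h
  intro k
  simp only [Function.comp_apply, map_smul, smul_pow]
  rw [hL (fun x => (pairE ζ x) ^ k) ((ell R ζ) ^ k) (fun x => rfl)]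
  simp only [smul_eq_mul]; ring

theorem nice_integrable {ν : Measure (Vd d)} (hν : FB ν) {g : Vd d → ℝ} {R : ℝ} (hg : Nice g R)
    {F : Vd d → ℝ} (hF : Continuous F) : Integrable (fun x => g x * F x) ν := by
  obtain ⟨hm, ⟨C, hC⟩, hs⟩ := hg
  obtain ⟨D, hD⟩ := (isCompact_closedBall (0 : Vd d) R).exists_bound_of_continuousOn hF.continuousOn
  have : IntegrableOn (fun x => g x * F x) (Metric.closedBall 0 R) ν := by
    refine IntegrableOn.of_bound (hν R) (hm.mul hF.measurable).aestronglyMeasurable (C * D) ?_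
    filter_upwards [ae_restrict_mem Metric.isClosed_closedBall.measurableSet] with x hx
    rw [norm_mul]
    exact mul_le_mul (hC _) (hD x hx) (norm_nonneg _) ((abs_nonneg _).trans (hC 0))
  exact (integrableOn_iff_integrable_of_support_subset (fun x hx => by
    by_contra h
    exact hx (by simp [hs x h]))).mp this

/-! ### generic validity near zero -/

/-- validity near `0` outside a closed set with empty interior. -/
def Gen (p : Vd d → Prop) : Prop :=
  ∃ Z : Set (Vd d), IsClosed Z ∧ interior Z = ∅ ∧ ∀ᶠ ξ in 𝓝 (0 : Vd d), ξ ∉ Z → p ξ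

theorem Gen.and {p q : Vd d → Prop} (hp : Gen p) (hq : Gen q) : Gen (fun ξ => p ξ ∧ q ξ) := by
  obtain ⟨Z, h1, h2, h3⟩ := hp
  obtain ⟨W, k1, k2, k3⟩ := hq
  refine ⟨Z ∪ W, h1.union k1, ?_, ?_⟩
  · rw [interior_union_isClosed_of_interior_empty h1 k2, h2]
  · filter_upwards [h3, k3] with ξ a b hξ
    exact ⟨a fun h => hξ (Or.inl h), b fun h => hξ (Or.inr h)⟩

theorem Gen.mono {p q : Vd d → Prop} (hp : Gen p) (h : ∀ ξ, p ξ → q ξ) : Gen q := by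
  obtain ⟨Z, h1, h2, h3⟩ := hp
  exact ⟨Z, h1, h2, h3.mono fun ξ a b => h _ (a b)⟩

theorem Gen.of_ev {p : Vd d → Prop} (hp : ∀ᶠ ξ in 𝓝 0, p ξ) : Gen p :=
  ⟨∅, isClosed_empty, interior_empty, hp.mono fun _ h _ => h⟩

theorem Gen.all {β : Type*} (s : Finset β) {p : β → Vd d → Prop} (hp : ∀ i ∈ s, Gen (p i)) :
    Gen (fun ξ => ∀ i ∈ s, p i ξ) := by
  classical
  induction s using Finset.induction_on with
  | empty => exact Gen.of_ev (by simp)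
  | insert a s ha ih =>
    refine ((hp a (by simp)).and (ih fun i hi => hp i (by simp [hi]))).mono ?_
    intro ξ h i hi
    rcases Finset.mem_insert.mp hi with rfl | hi
    · exact h.1
    · exact h.2 i hi

theorem Gen.ne {h : Vd d → ℝ} (ha : AnalyticAt ℝ h 0) (hn : ¬ ∀ᶠ ξ in 𝓝 (0 : Vd d), h ξ = 0) :
    Gen (fun ξ => h ξ ≠ 0) := by
  obtain ⟨r, hr, hA⟩ := Metric.eventually_nhds_iff_ball.mp ha.eventually_analyticAt
  have hon : AnalyticOnNhd ℝ h (Metric.ball 0 r) := fun x hx => hA x hx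
  refine ⟨Metric.closedBall 0 (r / 2) ∩ h ⁻¹' {0}, ?_, ?_, ?_⟩
  · refine ContinuousOn.preimage_isClosed_of_isClosed ?_ Metric.isClosed_closedBall isClosed_singleton
    exact hon.continuousOn.mono (Metric.closedBall_subset_ball (by linarith))
  · rw [Set.eq_empty_iff_forall_notMem]
    intro z hz
    apply hn
    have hz' := mem_interior_iff_mem_nhds.mp hz
    have h1 : h =ᶠ[𝓝 z] 0 := by
      filter_upwards [hz'] with y hy using hy.2
    have h2 := hon.eqOn_zero_of_preconnected_of_eventuallyEq_zero
      (convex_ball (0 : Vd d) r).isPreconnected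
      (Metric.closedBall_subset_ball (by linarith) (interior_subset hz).1) h1
    filter_upwards [Metric.ball_mem_nhds (0 : Vd d) hr] with ξ hξ using h2 hξ
  · filter_upwards [Metric.closedBall_mem_nhds (0 : Vd d) (half_pos hr)] with ξ hξ h1 h2
    exact h1 ⟨hξ, h2⟩

theorem Gen.eq_of_cont {f g : Vd d → ℝ} (h : Gen (fun ξ => f ξ = g ξ))
    (hf : ∀ᶠ ξ in 𝓝 (0 : Vd d), ContinuousAt f ξ) (hg : ∀ᶠ ξ in 𝓝 (0 : Vd d), ContinuousAt g ξ) :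
    ∀ᶠ ξ in 𝓝 (0 : Vd d), f ξ = g ξ := by
  obtain ⟨Z, h1, h2, h3⟩ := h
  filter_upwards [h3.eventually_nhds, hf, hg] with ξ a b c'
  have hd : Dense Zᶜ := interior_eq_empty_iff_dense_compl.mp h2
  have : (𝓝[Zᶜ] ξ).NeBot := mem_closure_iff_nhdsWithin_neBot.mp (hd ξ)
  have t1 : Tendsto f (𝓝[Zᶜ] ξ) (𝓝 (f ξ)) := b.tendsto.mono_left nhdsWithin_le_nhds
  have t2 : Tendsto g (𝓝[Zᶜ] ξ) (𝓝 (g ξ)) := c'.tendsto.mono_left nhdsWithin_le_nhds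
  refine tendsto_nhds_unique t1 (t2.congr' ?_)
  filter_upwards [nhdsWithin_le_nhds a, self_mem_nhdsWithin] with y hy hy'
  exact (hy hy').symm

/-- `M` is a quotient of analytic functions near `0`. -/
def Mero (M : Vd d → ℝ) : Prop :=
  ∃ g h : Vd d → ℝ, AnalyticAt ℝ g 0 ∧ AnalyticAt ℝ h 0 ∧
    (¬ ∀ᶠ ξ in 𝓝 (0 : Vd d), h ξ = 0) ∧
    (∀ᶠ ξ in 𝓝 (0 : Vd d), h ξ ≠ 0 → M ξ * h ξ = g ξ)

theorem mero_ident {M q n : Vd d → ℝ} (hM : Mero M) (hq : AnalyticAt ℝ q 0)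
    (hn : AnalyticAt ℝ n 0) {O : Set (Vd d)} (hO : IsOpen O)
    (hO0 : (0 : Vd d) ∈ closure O) (h : ∀ ξ ∈ O, M ξ * q ξ = n ξ) :
    Gen (fun ξ => M ξ * q ξ = n ξ) := by
  obtain ⟨g, k, hg, hk, hk0, hMk⟩ := hM
  have hA : AnalyticAt ℝ (fun ξ => (g ξ * q ξ - n ξ * k ξ) * k ξ) 0 :=
    (((hg.mul hq).sub (hn.mul hk)).mul hk)
  obtain ⟨r, hr, hr1⟩ := Metric.eventually_nhds_iff_ball.mp (hA.eventually_analyticAt.and hMk)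
  have hon : AnalyticOnNhd ℝ (fun ξ => (g ξ * q ξ - n ξ * k ξ) * k ξ) (Metric.ball 0 r) :=
    fun x hx => (hr1 x hx).1
  obtain ⟨z, hz1, hz2⟩ := mem_closure_iff_nhds.mp hO0 _ (Metric.ball_mem_nhds (0 : Vd d) hr)
  have hz : (fun ξ => (g ξ * q ξ - n ξ * k ξ) * k ξ) =ᶠ[𝓝 z] 0 := by
    filter_upwards [hO.mem_nhds hz2, Metric.isOpen_ball.mem_nhds hz1] with y hy1 hy2
    by_cases h0 : k y = 0
    · simp [h0]
    · have h1 := (hr1 y hy2).2 h0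
      have h2 := h y hy1
      simp only [Pi.zero_apply]
      rw [← h1, ← h2]; ring
  have hz3 := hon.eqOn_zero_of_preconnected_of_eventuallyEq_zero
      (convex_ball (0 : Vd d) r).isPreconnected hz1 hz
  refine ((Gen.ne hk hk0).and (Gen.of_ev (Metric.ball_mem_nhds (0 : Vd d) hr))).mono ?_
  rintro ξ ⟨h0, hb⟩
  have h1 := (hr1 ξ hb).2 h0
  have h2 : (g ξ * q ξ - n ξ * k ξ) * k ξ = 0 := hz3 hb
  rw [← h1] at h2
  have h3 : (M ξ * q ξ - n ξ) * (k ξ * k ξ) = 0 := by linarith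
  rcases mul_eq_zero.mp h3 with h4 | h4
  · linarith
  · exact absurd h4 (mul_ne_zero h0 h0)

end EM
end

noncomputable section
namespace EM
variable {d : ℕ}

/-! ### integrability of exponentials on cones -/

/-- the set `B + cone (u e, e ∈ s)`. -/
def Con {β : Type*} (u : β → Vd d) (B : Set (Vd d)) (s : Finset β) : Set (Vd d) :=
  {x | ∃ b ∈ B, ∃ t : β → ℝ, (∀ e ∈ s, 0 ≤ t e) ∧ x = b + ∑ e ∈ s, t e • u e}

theorem mp_iter {ν : Measure (Vd d)} {u : Vd d} (h : MeasurePreserving (fun x => x + u) ν ν) (k : ℕ) :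
    MeasurePreserving (fun x => x + (k : ℝ) • u) ν ν := by
  induction k with
  | zero =>
    have h0 : (fun x : Vd d => x + ((0 : ℕ) : ℝ) • u) = id := by ext x; simp
    rw [h0]; exact MeasurePreserving.id ν
  | succ k ih =>
    have := h.comp ih
    convert this using 2 with x
    simp [add_smul, add_assoc]

theorem ind_meas {F : Set (Vd d)} (hF : MeasurableSet F) : Measurable (ind F) :=
  measurable_const.indicator hF

theorem ind_abs (F : Set (Vd d)) (x) : |ind F x| ≤ 1 := by
  classical
  unfold ind; rw [Set.indicator_apply]; split_ifs <;> simp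

theorem ind_mul (F : Set (Vd d)) (f : Vd d → ℝ) : (fun x => ind F x * f x) = F.indicator f := by
  classical
  ext x; unfold ind; rw [Set.indicator_apply, Set.indicator_apply]; split_ifs <;> simp

theorem ind_nice {F : Set (Vd d)} (hF : MeasurableSet F) {R : ℝ} (hR : F ⊆ Metric.closedBall 0 R) :
    Nice (ind F) R :=
  ⟨ind_meas hF, ⟨1, ind_abs F⟩, fun _ hx => ind_zero fun h => hx (hR h)⟩

theorem con_finite {β : Type*} (u : β → Vd d) {ν : Measure (Vd d)} (hν : FB ν) (ξ : Vd d)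
    (s : Finset β) (hs : ∀ e ∈ s, MeasurePreserving (fun x => x + u e) ν ν)
    (hξ : ∀ e ∈ s, pairE ξ (u e) < 0) (B : Set (Vd d)) (R : ℝ) (hB : B ⊆ Metric.closedBall 0 R) :
    ∫⁻ x in Con u B s, ENNReal.ofReal (Real.exp (pairE ξ x)) ∂ν < ⊤ := by
  classical
  induction s using Finset.induction_on generalizing B R with
  | empty =>
    have h1 : Con u B ∅ ⊆ Metric.closedBall 0 R := by
      rintro x ⟨b, hb, t, _, rfl⟩; simpa using hB hb
    refine (lintegral_mono_set h1).trans_lt ?_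
    have hK : MeasurableSet (Metric.closedBall (0 : Vd d) R) := Metric.isClosed_closedBall.measurableSet
    have := nice_integrable hν (ind_nice hK subset_rfl) (continuous_exp_pairE ξ)
    rw [ind_mul, integrable_indicator_iff hK] at this
    exact (hasFiniteIntegral_iff_ofReal (Eventually.of_forall fun x => (Real.exp_pos _).le)).mp this.2
  | insert a s ha ih =>
    set B' : Set (Vd d) := {x | ∃ b ∈ B, ∃ r : ℝ, 0 ≤ r ∧ r ≤ 1 ∧ x = b + r • u a} with hB'
    have hB'R : B' ⊆ Metric.closedBall 0 (R + ‖u a‖) := by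
      rintro x ⟨b, hb, r, h0, h1, rfl⟩
      have := hB hb
      simp only [mem_closedBall_zero_iff] at this ⊢
      refine (norm_add_le _ _).trans (add_le_add this ?_)
      rw [norm_smul, Real.norm_of_nonneg h0]
      exact mul_le_of_le_one_left (norm_nonneg _) h1
    have hfin := ih (fun e he => hs e (by simp [he])) (fun e he => hξ e (by simp [he])) B' _ hB'R
    set J := ∫⁻ x in Con u B' s, ENNReal.ofReal (Real.exp (pairE ξ x)) ∂ν with hJ
    let S : ℕ → Set (Vd d) := fun k => {x | x - (k : ℝ) • u a ∈ Con u B' s}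
    have hsub : Con u B (insert a s) ⊆ ⋃ k, S k := by
      rintro x ⟨b, hb, t, ht, rfl⟩
      have hta := ht a (by simp)
      refine mem_iUnion.mpr ⟨⌊t a⌋₊, b + (t a - ⌊t a⌋₊) • u a, ⟨b, hb, _, ?_, ?_, rfl⟩, t,
        fun e he => ht e (by simp [he]), ?_⟩
      · linarith [Nat.floor_le hta]
      · linarith [Nat.lt_floor_add_one (t a)]
      · rw [Finset.sum_insert ha]; module
    refine (lintegral_mono_set hsub).trans_lt ((lintegral_iUnion_le _ _).trans_lt ?_)
    have hk : ∀ k : ℕ, ∫⁻ x in S k, ENNReal.ofReal (Real.exp (pairE ξ x)) ∂ν =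
        (ENNReal.ofReal (Real.exp (pairE ξ (u a)))) ^ k * J := by
      intro k
      have h1 := (mp_iter (hs a (by simp)) k).setLIntegral_comp_preimage_emb
        (MeasurableEquiv.addRight ((k : ℝ) • u a)).measurableEmbedding
        (fun x => ENNReal.ofReal (Real.exp (pairE ξ x))) (S k)
      have h2 : (fun x => x + (k : ℝ) • u a) ⁻¹' S k = Con u B' s := by
        ext x; simp [S]
      rw [← h1, h2, hJ, ← lintegral_const_mul' _ _ (by finiteness)]
      congr 1; ext x
      rw [pairE_add, pairE_smul, Real.exp_add, mul_comm, ENNReal.ofReal_mul (Real.exp_pos _).le,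
        Real.exp_nat_mul, ENNReal.ofReal_pow (Real.exp_pos _).le]
    simp_rw [hk]
    rw [ENNReal.tsum_mul_right, ENNReal.tsum_geometric]
    refine ENNReal.mul_lt_top ?_ hfin
    rw [ENNReal.inv_lt_top, tsub_pos_iff_lt]
    rw [ENNReal.ofReal_lt_one]
    rw [← Real.exp_zero]; exact Real.exp_lt_exp.mpr (hξ a (by simp))

variable {ι : Type*} {φ : ι → Vd d} {c : ι → ℝ} [Finite ι]

theorem KC_meas {v : Vd d} (hv : v ∈ HP φ c) : MeasurableSet (KC v (HP φ c)) := by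
  rw [KC_HP' hv]; exact HP_closed.measurableSet

theorem KC_integrable (hb : Bornology.IsBounded (HP φ c)) {ν : Measure (Vd d)} (hν : FB ν) {N : ℕ}
    (hN : 0 < N) 
    (hinv : ∀ v ∈ Vx φ c, ∀ w ∈ Vx φ c, MeasurePreserving (fun x => x + (N : ℝ) • (w - v)) ν ν)
    {v : Vd d} (hv : v ∈ Vx φ c) {ξ : Vd d} (hξ : ∀ w ∈ Vx φ c, w ≠ v → pairE ξ (w - v) < 0) :
    IntegrableOn (fun x => Real.exp (pairE ξ x)) (KC v (HP φ c)) ν := by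
  classical
  refine ⟨(continuous_exp_pairE ξ).aestronglyMeasurable, ?_⟩
  rw [hasFiniteIntegral_iff_ofReal (Eventually.of_forall fun x => (Real.exp_pos _).le)]
  have hN' : (0 : ℝ) < N := by exact_mod_cast hN
  refine lt_of_le_of_lt (lintegral_mono_set ?_) (con_finite (fun w => (N : ℝ) • (w - v)) hν ξ
    ((Vx φ c).erase v) ?_ ?_ {v} ‖v‖ ?_)
  · intro z hz
    obtain ⟨s, hs, rfl⟩ := KC_comb hb hz
    refine ⟨v, rfl, fun w => s w / N, fun w hw => div_nonneg (hs w (Finset.mem_of_mem_erase hw)) hN'.le, ?_⟩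
    rw [← Finset.add_sum_erase _ _ hv]
    simp only [sub_self, smul_zero, zero_add, smul_smul, div_mul_cancel₀ _ hN'.ne']
  · exact fun w hw => hinv v hv w (Finset.mem_of_mem_erase hw)
  · intro w hw
    rw [pairE_smul]
    exact mul_neg_of_pos_of_neg hN' (hξ w (Finset.mem_of_mem_erase hw) (Finset.ne_of_mem_erase hw))
  · simp

theorem pairE_comm (x y : Vd d) : pairE x y = pairE y x := real_inner_comm _ _

theorem pairE_analytic (u : Vd d) (ξ : Vd d) : AnalyticAt ℝ (fun ξ => pairE ξ u) ξ := by
  have : (fun ξ => pairE ξ u) = innerSL ℝ u := by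
    ext ξ; rw [pairE_comm]; rfl
  rw [this]; exact (innerSL ℝ u).analyticAt _

theorem pairE_self_pos {u : Vd d} (hu : u ≠ 0) : 0 < pairE u u := real_inner_self_pos.mpr hu

theorem one_sub_exp_analytic (u ξ : Vd d) : AnalyticAt ℝ (fun ξ => 1 - Real.exp (pairE ξ u)) ξ :=
  analyticAt_const.sub (pairE_analytic u ξ).rexp

theorem gen_del {u : Vd d} (hu : u ≠ 0) : Gen (fun ξ => 1 - Real.exp (pairE ξ u) ≠ 0) := by
  apply Gen.ne (one_sub_exp_analytic u 0)
  intro h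
  have ht : Tendsto (fun t : ℝ => t • u) (𝓝[>] 0) (𝓝 0) := by
    have : Tendsto (fun t : ℝ => t • u) (𝓝 0) (𝓝 ((0 : ℝ) • u)) := by
      exact (continuous_id.smul continuous_const).tendsto 0
    rw [zero_smul] at this
    exact this.mono_left nhdsWithin_le_nhds
  obtain ⟨t, h1, h2⟩ := ((ht.eventually h).and self_mem_nhdsWithin).exists
  have h2 : 0 < t := h2
  rw [pairE_smul_left] at h1
  have := Real.one_lt_exp_iff.mpr (mul_pos h2 (pairE_self_pos hu))
  linarith

open Classical in
theorem brion_gen (hb : Bornology.IsBounded (HP φ c)) {ν : Measure (Vd d)} (hν : FB ν) {N : ℕ}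
    (hN : 0 < N)
    (hinv : ∀ v ∈ Vx φ c, ∀ w ∈ Vx φ c, MeasurePreserving (fun x => x + (N : ℝ) • (w - v)) ν ν)
    (M : Vd d → Vd d → ℝ) (hM : ∀ v ∈ Vx φ c, Mero (M v))
    (hMI : ∀ v ∈ Vx φ c, ∀ ξ, IntegrableOn (fun x => Real.exp (pairE ξ x)) (KC v (HP φ c)) ν →
      M v ξ = ∫ x in KC v (HP φ c), Real.exp (pairE ξ x) ∂ν) :
    Gen (fun ξ => ∫ x in HP φ c, Real.exp (pairE ξ x) ∂ν = ∑ v ∈ Vx φ c, M v ξ) := by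
  have hN' : (0 : ℝ) < N := by exact_mod_cast hN
  set X := Vx φ c with hX
  set P := HP φ c with hP
  have hmemP : ∀ v ∈ X, v ∈ P := fun v hv => (mem_Vx.mp hv).1
  have hPm : MeasurableSet P := HP_closed.measurableSet
  set q : Vd d → ℝ := fun ξ => ev ξ (dU X N) with hq
  have hqe : ∀ ξ, q ξ = ∏ p ∈ X.offDiag, (1 - Real.exp (pairE ξ ((N : ℝ) • (p.2 - p.1)))) := by
    intro ξ; simp only [hq, dU, map_prod, ev_del]
  have hqa : AnalyticAt ℝ q 0 := by
    have : q = fun ξ => ∏ p ∈ X.offDiag, (1 - Real.exp (pairE ξ ((N : ℝ) • (p.2 - p.1)))) := funext hqe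
    rw [this]
    exact Finset.analyticAt_fun_prod _ fun p _ => one_sub_exp_analytic _ _
  have hq0 : Gen (fun ξ => q ξ ≠ 0) := by
    refine (Gen.all (X.offDiag) (p := fun p ξ => 1 - Real.exp (pairE ξ ((N : ℝ) • (p.2 - p.1))) ≠ 0)
      fun p hp => gen_del ?_).mono ?_
    · rw [Finset.mem_offDiag] at hp
      exact smul_ne_zero hN'.ne' (sub_ne_zero.mpr fun h => hp.2.2 h.symm)
    · intro ξ h
      rw [hqe]; exact Finset.prod_ne_zero_iff.mpr h
  have hmp : ∀ p ∈ X.offDiag, MeasurePreserving (fun x => x + (N : ℝ) • (p.2 - p.1)) ν ν := by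
    intro p hp
    rw [Finset.mem_offDiag] at hp
    exact hinv _ hp.1 _ hp.2.1
  obtain ⟨κ, hκ, hk⟩ := exists_kappa φ c
  have hnice : ∀ v ∈ X, Nice (act (dU X N) (ind (KC v P))) (‖v‖ + N * ((κ + 1) * R1 X)) := by
    intro v hv
    obtain ⟨h1, h2⟩ := act_prod_bdd X.offDiag (fun p => (N : ℝ) • (p.2 - p.1)) (ind (KC v P))
      ⟨ind_meas (KC_meas (hmemP v hv)), 1, ind_abs _⟩
    refine ⟨h1, h2, fun x hx => ?_⟩
    by_contra h
    have := lemA hb hκ hk hv hN' x h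
    apply hx
    rw [mem_closedBall_zero_iff]
    calc ‖x‖ = ‖v + (x - v)‖ := by congr 1; abel
      _ ≤ _ := (norm_add_le _ _).trans (by gcongr)
  have hv1 : ∀ v ∈ X, Gen (fun ξ => M v ξ * q ξ = lap ν (act (dU X N) (ind (KC v P))) ξ) := by
    intro v hv
    refine mero_ident (hM v hv) hqa (lap_analytic hν (hnice v hv) 0)
      (O := {ξ | ∀ w ∈ X, w ≠ v → pairE ξ (w - v) < 0}) ?_ ?_ ?_
    · have : {ξ : Vd d | ∀ w ∈ X, w ≠ v → pairE ξ (w - v) < 0} =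
          ⋂ w ∈ X.erase v, {ξ : Vd d | pairE ξ (w - v) < 0} := by
        ext ξ; simp only [mem_ofPred_eq, mem_iInter, Finset.mem_erase]; tauto
      rw [this]
      exact isOpen_biInter_finset fun w _ =>
        isOpen_lt (continuous_pairE_left _) continuous_const
    · obtain ⟨ξ, hξ⟩ := exists_neg hv
      have ht : Tendsto (fun t : ℝ => t • ξ) (𝓝[>] 0) (𝓝 0) := by
        have : Tendsto (fun t : ℝ => t • ξ) (𝓝 0) (𝓝 ((0 : ℝ) • ξ)) := by
          exact (continuous_id.smul continuous_const).tendsto 0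
        rw [zero_smul] at this
        exact this.mono_left nhdsWithin_le_nhds
      refine mem_closure_of_tendsto ht ?_
      filter_upwards [self_mem_nhdsWithin] with t ht w hw hne
      rw [pairE_smul_left]
      exact mul_neg_of_pos_of_neg ht (hξ w hw hne)
    · intro ξ hξ
      have hitg := KC_integrable hb hν hN hinv hv hξ
      rw [hMI v hv ξ hitg]
      have hKm := KC_meas (hmemP v hv)
      have hi2 : Integrable (fun x => ind (KC v P) x * Real.exp (pairE ξ x)) ν := by
        rw [ind_mul, integrable_indicator_iff hKm]; exact hitg
      have := (int_prod X.offDiag (fun p => (N : ℝ) • (p.2 - p.1)) (ind (KC v P)) ν hmp ξ hi2).2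
      unfold lap
      simp only [dU, hq]
      rw [this, mul_comm, ind_mul, integral_indicator hKm]
  have hbound : ∃ R, P ⊆ Metric.closedBall 0 R := hb.subset_closedBall 0
  obtain ⟨R, hR⟩ := hbound
  have hmain : ∀ ξ, q ξ * ∫ x in P, Real.exp (pairE ξ x) ∂ν =
      ∑ v ∈ X, lap ν (act (dU X N) (ind (KC v P))) ξ := by
    intro ξ
    have hi := nice_integrable hν (ind_nice hPm hR) (continuous_exp_pairE ξ)
    have := (int_prod X.offDiag (fun p => (N : ℝ) • (p.2 - p.1)) (ind P) ν hmp ξ hi).2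
    rw [ind_mul, integral_indicator hPm] at this
    have h2 : q ξ = ev ξ (∏ p ∈ X.offDiag, del ((N : ℝ) • (p.2 - p.1))) := rfl
    rw [h2, ← this]
    have h3 := brion_ind hb N
    rw [map_sub, map_sum, sub_eq_zero] at h3
    have h4 : act (∏ p ∈ X.offDiag, del ((N : ℝ) • (p.2 - p.1))) (ind P) =
      ∑ v ∈ X, act (dU X N) (ind (KC v P)) := h3
    rw [h4]
    unfold lap
    rw [← integral_finsetSum]
    · congr 1; ext x; rw [Finset.sum_apply, Finset.sum_mul]
    · intro v hv
      exact nice_integrable hν (hnice v hv) (continuous_exp_pairE ξ)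
  refine (hq0.and (Gen.all X hv1)).mono ?_
  rintro ξ ⟨h0, h1⟩
  have h2 := hmain ξ
  rw [← Finset.sum_congr rfl h1, ← Finset.sum_mul, mul_comm] at h2
  exact mul_right_cancel₀ h0 h2

end EM
end

noncomputable section
namespace EM
variable {d : ℕ}

/-! ### lattices and rationality -/

theorem lat_basis {Λ : AddSubgroup (Vd d)} (hΛ : IsFullLattice Λ) :
    ∃ (k : ℕ) (B : Module.Basis (Fin k) ℝ (Vd d)),
      (Λ : Set (Vd d)) = (Submodule.span ℤ (Set.range B) : Set (Vd d)) ∧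
      ∀ x, x ∈ Λ ↔ ∀ i, ∃ n : ℤ, (n : ℝ) = B.repr x i := by
  obtain ⟨⟨k, v, hv, rfl⟩, hs⟩ := hΛ
  have hs' : ⊤ ≤ Submodule.span ℝ (Set.range v) := by
    rw [← hs, Submodule.span_le]
    intro x hx
    have : AddSubgroup.closure (Set.range v) ≤ (Submodule.span ℝ (Set.range v)).toAddSubgroup := by
      rw [AddSubgroup.closure_le]; exact Submodule.subset_span
    exact this hx
  have hB : (AddSubgroup.closure (Set.range v) : Set (Vd d)) = 
      (Submodule.span ℤ (Set.range (Module.Basis.mk hv hs')) : Set (Vd d)) := by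
    rw [Module.Basis.coe_mk, ← Submodule.span_int_eq_addSubgroupClosure]; rfl
  refine ⟨k, Module.Basis.mk hv hs', hB, fun x => ?_⟩
  have h2 := Module.Basis.mem_span_iff_repr_mem ℤ (Module.Basis.mk hv hs') x
  have h3 : x ∈ AddSubgroup.closure (Set.range v) ↔
      x ∈ Submodule.span ℤ (Set.range (Module.Basis.mk hv hs')) := by
    rw [← SetLike.mem_coe, hB]; rfl
  rw [h3, h2]
  simp

theorem rat_retract : ∃ f : ℝ →ₗ[ℚ] ℚ, ∀ q : ℚ, f (q : ℝ) = q := by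
  obtain ⟨f, hf⟩ := LinearMap.exists_leftInverse_of_injective (Algebra.linearMap ℚ ℝ)
    (LinearMap.ker_eq_bot.mpr (algebraMap ℚ ℝ).injective)
  exact ⟨f, fun q => by simpa using LinearMap.congr_fun hf q⟩

variable {ι : Type*} {φ : ι → Vd d} {c : ι → ℚ}

theorem vertex_rat [Finite ι] {Λ : AddSubgroup (Vd d)} (hΛ : IsFullLattice Λ)
    (hφ : ∀ i, IsDualIntegral Λ (φ i)) {v : Vd d} (hv : v ∈ Vx φ (fun i => (c i : ℝ))) :
    IsRatPoint Λ v := by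
  obtain ⟨k, B, hB1, hB⟩ := lat_basis hΛ
  obtain ⟨f, hf⟩ := rat_retract
  rw [mem_Vx] at hv
  set v' : Vd d := ∑ j, ((f (B.repr v j) : ℚ) : ℝ) • B j with hv'
  have hBm : ∀ j, B j ∈ Λ := by
    intro j
    rw [← SetLike.mem_coe, hB1]; exact Submodule.subset_span ⟨j, rfl⟩
  have key : v' - v = 0 := by
    apply ext_ker hv
    intro i hi
    choose n hn using fun j => hφ i (B j) (hBm j)
    have e1 : pairE (φ i) v = ∑ j, (n j : ℝ) * B.repr v j := by
      conv_lhs => rw [← B.sum_repr v, pairE_sum]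
      exact Finset.sum_congr rfl fun j _ => by rw [pairE_smul, hn]; ring
    have e2 : pairE (φ i) v' = ((f (pairE (φ i) v) : ℚ) : ℝ) := by
      rw [e1, map_sum, hv', pairE_sum]
      push_cast
      refine Finset.sum_congr rfl fun j _ => ?_
      have : (n j : ℝ) * B.repr v j = ((n j : ℚ)) • B.repr v j := by
        rw [Rat.smul_def]; push_cast; rfl
      rw [pairE_smul, hn, this, map_smul]
      push_cast [smul_eq_mul]; ring
    rw [pairE_sub, e2, hi, hf, sub_self]
  have hvv : v' = v := sub_eq_zero.mp key
  have hq : ∀ j, B.repr v j = ((f (B.repr v j) : ℚ) : ℝ) := by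
    intro j
    conv_lhs => rw [← hvv, hv']
    rw [B.repr_sum_self]
  set D : ℤ := ∏ j, ((f (B.repr v j)).den : ℤ) with hD
  refine ⟨D, Finset.prod_ne_zero_iff.mpr fun j _ => by simp, ?_⟩
  rw [hB]
  intro j
  obtain ⟨e, he⟩ : ((f (B.repr v j)).den : ℤ) ∣ D := Finset.dvd_prod_of_mem _ (Finset.mem_univ j)
  refine ⟨e * (f (B.repr v j)).num, ?_⟩
  clear hD
  clear_value D
  rw [map_smul, Finsupp.smul_apply, smul_eq_mul, he]
  have hqj := hq j
  generalize hqd : f (B.repr v j) = q at *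
  rw [hqj]
  have : (q.den : ℝ) * (q : ℝ) = q.num := by exact_mod_cast Rat.den_mul_eq_num q
  push_cast
  rw [← this]; ring

theorem rat_nat {Λ : AddSubgroup (Vd d)} {x : Vd d} (h : IsRatPoint Λ x) :
    ∃ n : ℕ, 0 < n ∧ (n : ℝ) • x ∈ Λ := by
  obtain ⟨q, hq, hx⟩ := h
  refine ⟨q.natAbs, Int.natAbs_pos.mpr hq, ?_⟩
  rcases Int.natAbs_eq q with h | h
  · rw [h] at hx; simpa using hx
  · rw [h] at hx
    have := Λ.neg_mem hx
    push_cast at this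
    rw [neg_smul, neg_neg] at this
    simpa using this

theorem nat_mul_mem {Λ : AddSubgroup (Vd d)} {x : Vd d} (h : x ∈ Λ) (n : ℕ) : (n : ℝ) • x ∈ Λ := by
  rw [Nat.cast_smul_eq_nsmul]; exact Λ.nsmul_mem h n

theorem common_N {Λ : AddSubgroup (Vd d)} (X : Finset (Vd d)) (h : ∀ x ∈ X, IsRatPoint Λ x) :
    ∃ N : ℕ, 0 < N ∧ ∀ x ∈ X, (N : ℝ) • x ∈ Λ := by
  classical
  induction X using Finset.induction_on with
  | empty => exact ⟨1, one_pos, by simp⟩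
  | insert a s ha ih =>
    obtain ⟨N, hN, h1⟩ := ih fun x hx => h x (by simp [hx])
    obtain ⟨n, hn, h2⟩ := rat_nat (h a (by simp))
    refine ⟨N * n, Nat.mul_pos hN hn, fun x hx => ?_⟩
    push_cast
    rcases Finset.mem_insert.mp hx with rfl | hx
    · rw [mul_smul]; exact nat_mul_mem h2 N
    · rw [mul_comm, mul_smul]; exact nat_mul_mem (h1 x hx) n

theorem lat_diff {Λ : AddSubgroup (Vd d)} {N : ℕ} {X : Finset (Vd d)}
    (h : ∀ x ∈ X, (N : ℝ) • x ∈ Λ) : ∀ v ∈ X, ∀ w ∈ X, (N : ℝ) • (w - v) ∈ Λ := by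
  intro v hv w hw
  rw [smul_sub]; exact Λ.sub_mem (h w hw) (h v hv)

theorem lat_finite {Λ : AddSubgroup (Vd d)} (hΛ : IsFullLattice Λ) {s : Set (Vd d)}
    (hs : Bornology.IsBounded s) : (s ∩ (Λ : Set (Vd d))).Finite := by
  obtain ⟨k, B, hB, -⟩ := lat_basis hΛ
  rw [hB]; exact ZSpan.setFinite_inter B hs

theorem lat_countable {Λ : AddSubgroup (Vd d)} (hΛ : IsFullLattice Λ) :
    (Λ : Set (Vd d)).Countable := by
  have : (Λ : Set (Vd d)) = ⋃ n : ℕ, Metric.closedBall 0 (n : ℝ) ∩ (Λ : Set (Vd d)) := by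
    rw [← iUnion_inter, Metric.iUnion_closedBall_nat, univ_inter]
  rw [this]
  exact countable_iUnion fun n => (lat_finite hΛ Metric.isBounded_closedBall).countable

/-- counting measure on the lattice. -/
def nuL (Λ : AddSubgroup (Vd d)) : Measure (Vd d) := Measure.count.restrict (Λ : Set (Vd d))

theorem nuL_FB {Λ : AddSubgroup (Vd d)} (hΛ : IsFullLattice Λ) : FB (nuL Λ) := by
  intro R
  unfold nuL
  rw [Measure.restrict_apply Metric.isClosed_closedBall.measurableSet]
  exact Measure.count_apply_lt_top.mpr (lat_finite hΛ Metric.isBounded_closedBall)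

theorem nuL_inv {Λ : AddSubgroup (Vd d)} {u : Vd d} (hu : u ∈ Λ) :
    MeasurePreserving (fun x => x + u) (nuL Λ) (nuL Λ) := by
  have h1 : MeasurePreserving (fun x : Vd d => x + u) Measure.count Measure.count :=
    measurePreserving_add_right _ u
  have h2 := h1.restrict_preimage_emb (MeasurableEquiv.addRight u).measurableEmbedding
    (Λ : Set (Vd d))
  have h3 : (fun x : Vd d => x + u) ⁻¹' (Λ : Set (Vd d)) = Λ := by
    ext x; simp [Λ.add_mem_cancel_right hu]
  rwa [h3] at h2

theorem nuL_restrict {Λ : AddSubgroup (Vd d)} {S : Set (Vd d)} (hS : MeasurableSet S) :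
    (nuL Λ).restrict S = Measure.count.restrict (S ∩ (Λ : Set (Vd d))) := by
  unfold nuL; rw [Measure.restrict_restrict hS]

theorem nuL_summable {Λ : AddSubgroup (Vd d)} (hΛ : IsFullLattice Λ) {S : Set (Vd d)}
    (hS : MeasurableSet S) {f : Vd d → ℝ} (hf0 : ∀ x, 0 ≤ f x) (hf : IntegrableOn f S (nuL Λ)) :
    Summable (fun x : ↥(S ∩ (Λ : Set (Vd d))) => f x) ∧
    ∫ x in S, f x ∂(nuL Λ) = ∑' x : ↥(S ∩ (Λ : Set (Vd d))), f x := by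
  have hc : (S ∩ (Λ : Set (Vd d))).Countable := (lat_countable hΛ).mono inter_subset_right
  unfold IntegrableOn at hf
  rw [nuL_restrict hS] at hf ⊢
  constructor
  · have := (hasFiniteIntegral_iff_ofReal (Eventually.of_forall hf0)).mp hf.2
    rw [lintegral_countable _ hc] at this
    simp only [Measure.count_singleton, mul_one] at this
    have h2 := ENNReal.summable_toReal this.ne
    simpa [ENNReal.toReal_ofReal (hf0 _)] using h2
  · rw [setIntegral_countable _ hc hf]
    simp [Measure.real]

theorem nuL_finsum {Λ : AddSubgroup (Vd d)} (hΛ : IsFullLattice Λ) {S : Set (Vd d)}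
    (hS : MeasurableSet S) (hb : Bornology.IsBounded S) (f : Vd d → ℝ) :
    ∫ x in S, f x ∂(nuL Λ) = ∑ᶠ x ∈ S ∩ (Λ : Set (Vd d)), f x := by
  rw [nuL_restrict hS]
  have hfin := lat_finite hΛ hb
  rw [finsum_mem_eq_finite_toFinset_sum _ hfin]
  have : S ∩ (Λ : Set (Vd d)) = ((hfin.toFinset : Finset (Vd d)) : Set (Vd d)) := by simp
  have hi : IntegrableOn f ((hfin.toFinset : Finset (Vd d)) : Set (Vd d)) Measure.count := by
    rw [← Set.biUnion_of_singleton ((hfin.toFinset : Finset (Vd d)) : Set (Vd d)),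
      integrableOn_finite_biUnion (Finset.finite_toSet _)]
    intro x _
    exact integrableOn_singleton (by simp) (by rw [Measure.count_singleton]; exact ENNReal.one_lt_top)
  have h2 : ∫ x in S ∩ (Λ : Set (Vd d)), f x ∂Measure.count =
      ∫ x in ((hfin.toFinset : Finset (Vd d)) : Set (Vd d)), f x ∂Measure.count :=
    congrArg (fun s => ∫ x in s, f x ∂Measure.count) this
  rw [h2, setIntegral_finset _ hi]
  simp [Measure.real]

theorem quot_self (Q : Vd d →ₗ[ℝ] Vd d →ₗ[ℝ] ℝ) (Λ : AddSubgroup (Vd d)) : IsQuotLattice Q Λ Λ := by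
  refine ⟨⊥, LinearMap.id, ?_, ⟨fun x => by simp, fun x y hy => ?_⟩, ?_⟩
  · rw [eq_bot_iff, Submodule.span_le]; exact inter_subset_left
  · rw [Submodule.mem_bot] at hy; simp [hy]
  · ext x; simp

theorem HP_rat {Λ : AddSubgroup (Vd d)} (hΛ : IsFullLattice Λ) [Finite ι]
    (hφ : ∀ i, IsDualIntegral Λ (φ i)) : IsRatPolyhedron Λ (HP φ (fun i => (c i : ℝ))) := by
  obtain ⟨n, ⟨e⟩⟩ := Finite.exists_equiv_fin ι
  refine ⟨n, φ ∘ e.symm, c ∘ e.symm, fun i => hφ _, ?_⟩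
  rw [hΛ.2]
  ext x
  simp only [HP, Submodule.mem_top, true_and, Function.comp_apply, mem_ofPred_eq]
  exact ⟨fun h i => h _, fun h i => by simpa using h (e i)⟩

theorem KC_cone [Finite ι] {Λ : AddSubgroup (Vd d)} (hΛ : IsFullLattice Λ)
    (hφ : ∀ i, IsDualIntegral Λ (φ i)) (hb : Bornology.IsBounded (HP φ (fun i => (c i : ℝ))))
    {v : Vd d} (hv : v ∈ Vx φ (fun i => (c i : ℝ))) :
    IsRatAffineCone Λ (KC v (HP φ (fun i => (c i : ℝ)))) := by
  classical
  set X := Vx φ (fun i => (c i : ℝ)) with hX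
  obtain ⟨N, hN, hNX⟩ := common_N X (fun x hx => vertex_rat hΛ hφ hx)
  have hN' : (0 : ℝ) < N := by exact_mod_cast hN
  have hd := lat_diff hNX
  let e := X.equivFin
  refine ⟨v, X.card, fun i => (N : ℝ) • (((e.symm i : X) : Vd d) - v), vertex_rat hΛ hφ hv,
    fun i => hd v hv _ (e.symm i).2, ?_⟩
  have hsum : ∀ g : Vd d → Vd d, ∑ w ∈ X, g w = ∑ i, g (e.symm i : X) := by
    intro g
    rw [← Finset.sum_coe_sort]
    exact (Equiv.sum_comp e.symm (fun w : X => g w)).symm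
  ext z
  constructor
  · intro hz
    obtain ⟨s, hs, rfl⟩ := KC_comb hb hz
    refine ⟨fun i => s (e.symm i : X) / N, fun i => div_nonneg (hs _ (e.symm i).2) hN'.le, ?_⟩
    simp only [smul_smul, div_mul_cancel₀ _ hN'.ne']
    rw [← hX, hsum]
  · rintro ⟨t, ht, rfl⟩
    have := KC_of_comb (mem_Vx.mp hv).1 (fun w => if h : w ∈ X then t (e ⟨w, h⟩) * N else 0)
      (fun w hw => by rw [dif_pos hw]; exact mul_nonneg (ht _) hN'.le)
    rw [← hX, hsum] at this
    simpa [smul_smul] using this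

theorem mero_of_rat {Λ : AddSubgroup (Vd d)} {f : Vd d → ℝ} (h : RatMeromorphicAt0 Λ f) : Mero f := by
  obtain ⟨g, k, ⟨p, hp, -⟩, ⟨r, hr, -⟩, h3, h4⟩ := h
  exact ⟨g, k, ⟨p, hp⟩, ⟨r, hr⟩, h3, h4⟩

/-! ### canonical measures -/

theorem canon_cont {k : ℕ} (x₀ : Vd d) (v : Fin k → Vd d) :
    Continuous (fun t : Fin k → ℝ => x₀ + ∑ i, t i • v i) := by fun_prop

theorem canon_FB {Λ : AddSubgroup (Vd d)} {A : Set (Vd d)} {m : Measure (Vd d)}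
    (h : IsCanonicalMeasure Λ A m) : FB m := by
  obtain ⟨k, x₀, v, -, -, hv, -, -, rfl⟩ := h
  intro R
  rw [Measure.map_apply (canon_cont x₀ v).measurable Metric.isClosed_closedBall.measurableSet]
  apply Bornology.IsBounded.measure_lt_top
  let T : (Fin k → ℝ) →ₗ[ℝ] Vd d := Fintype.linearCombination ℝ v
  have hT : LinearMap.ker T = ⊥ := LinearMap.ker_eq_bot.mpr (linearIndependent_iff_injective_fintypeLinearCombination.mp hv)
  obtain ⟨K, hK, hK2⟩ := (LinearMap.toContinuousLinearMap T).exists_antilipschitzWith hT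
  have := hK2.isBounded_preimage (Metric.isBounded_closedBall (x := -x₀) (r := R))
  refine this.subset ?_
  intro t ht
  simp only [mem_preimage, Metric.mem_closedBall, dist_zero_right] at ht ⊢
  rw [dist_eq_norm]
  have e : (LinearMap.toContinuousLinearMap T) t - -x₀ = x₀ + ∑ i, t i • v i := by
    have : (LinearMap.toContinuousLinearMap T) t = ∑ i, t i • v i := by
      simp [T, Fintype.linearCombination_apply]
    rw [this]; abel
  exact (congrArg norm e).le.trans ht

theorem canon_inv {Λ : AddSubgroup (Vd d)} {A : Set (Vd d)} {m : Measure (Vd d)}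
    (h : IsCanonicalMeasure Λ A m) {a b : Vd d} (ha : a ∈ A) (hb : b ∈ A) (r : ℝ) :
    MeasurePreserving (fun x => x + r • (b - a)) m m := by
  obtain ⟨k, x₀, v, -, -, hv, hA, -, rfl⟩ := h
  rw [hA] at ha hb
  obtain ⟨s, rfl⟩ := ha
  obtain ⟨t, rfl⟩ := hb
  refine ⟨measurable_add_const _, ?_⟩
  have hc := (canon_cont x₀ v).measurable
  rw [Measure.map_map (measurable_add_const _) hc]
  have e : ((fun x => x + r • (x₀ + ∑ i, t i • v i - (x₀ + ∑ i, s i • v i))) ∘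
      fun t : Fin k → ℝ => x₀ + ∑ i, t i • v i) =
      (fun t : Fin k → ℝ => x₀ + ∑ i, t i • v i) ∘ (fun z => z + r • (t - s)) := by
    ext1 z
    simp only [Function.comp_apply, Pi.add_apply, Pi.smul_apply, Pi.sub_apply, smul_eq_mul,
      add_smul, mul_smul, sub_smul, Finset.sum_add_distrib, ← Finset.smul_sum, Finset.sum_sub_distrib,
      smul_sub]
    module
  rw [e, ← Measure.map_map hc (measurable_add_const _),
    (measurePreserving_add_right volume (r • (t - s))).map_eq]

end EM
end

noncomputable section
namespace EM
variable {d : ℕ}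

/-! ### faces -/

/-- the constraints active on all of `F`. -/
def Jset {ι : Type*} (φ : ι → Vd d) (c : ι → ℝ) (F : Set (Vd d)) : Set ι :=
  {i | ∀ x ∈ F, pairE (φ i) x = c i}

variable {ι : Type*} {φ : ι → Vd d} {c : ι → ℝ}

theorem strict_pt [Finite ι] {F : Set (Vd d)} (hF : F ⊆ HP φ c) (hc : Convex ℝ F) (hn : F.Nonempty) :
    ∃ y ∈ F, ∀ i, i ∉ Jset φ c F → pairE (φ i) y < c i := by
  classical
  have := Fintype.ofFinite ι
  suffices h : ∀ s : Finset ι, ∃ y ∈ F, ∀ i ∈ s, i ∉ Jset φ c F → pairE (φ i) y < c i by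
    obtain ⟨y, hy, h⟩ := h Finset.univ
    exact ⟨y, hy, fun i => h i (Finset.mem_univ i)⟩
  intro s
  induction s using Finset.induction_on with
  | empty => obtain ⟨y, hy⟩ := hn; exact ⟨y, hy, by simp⟩
  | insert a s ha ih =>
    obtain ⟨y, hy, h⟩ := ih
    by_cases haJ : a ∈ Jset φ c F
    · refine ⟨y, hy, fun i hi hiJ => ?_⟩
      rcases Finset.mem_insert.mp hi with rfl | hi
      · exact absurd haJ hiJ
      · exact h i hi hiJ
    · have : ∃ x ∈ F, pairE (φ a) x ≠ c a := by simpa [Jset] using haJ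
      obtain ⟨x, hx, hxa⟩ := this
      refine ⟨(1/2 : ℝ) • x + (1/2 : ℝ) • y, hc hx hy (by norm_num) (by norm_num) (by norm_num), ?_⟩
      intro i hi hiJ
      rw [pairE_add, pairE_smul, pairE_smul]
      have h1 := hF hx i
      have h2 := hF hy i
      rcases Finset.mem_insert.mp hi with rfl | hi
      · have := lt_of_le_of_ne h1 hxa
        linarith
      · have := h i hi hiJ
        linarith

theorem face_sub {P F : Set (Vd d)} (h : IsFaceOf P F) : F ⊆ P := by
  obtain ⟨-, ψ, rfl⟩ := h
  exact fun x hx => hx.1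

theorem face_convex {P F : Set (Vd d)} (hP : Convex ℝ P) (h : IsFaceOf P F) : Convex ℝ F := by
  obtain ⟨-, ψ, rfl⟩ := h
  intro x hx y hy a b ha hb hab
  refine ⟨hP hx.1 hy.1 ha hb hab, fun z hz => ?_⟩
  rw [pairE_add, pairE_smul, pairE_smul]
  have h1 := mul_le_mul_of_nonneg_left (hx.2 z hz) ha
  have h2 := mul_le_mul_of_nonneg_left (hy.2 z hz) hb
  have : pairE ψ z = a * pairE ψ z + b * pairE ψ z := by rw [← add_mul, hab, one_mul]
  linarith

theorem face_eq [Finite ι] {F : Set (Vd d)} (h : IsFaceOf (HP φ c) F) :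
    F = {x | x ∈ HP φ c ∧ ∀ i ∈ Jset φ c F, pairE (φ i) x = c i} := by
  obtain ⟨y, hy, hys⟩ := strict_pt (face_sub h) (face_convex HP_convex h) h.1
  ext x
  constructor
  · intro hx
    exact ⟨face_sub h hx, fun i hi => hi x hx⟩
  · rintro ⟨hx, hJ⟩
    obtain ⟨-, ψ, hψ⟩ := h
    have hyP : y ∈ HP φ c := by rw [hψ] at hy; exact hy.1
    have hmax : ∀ z ∈ HP φ c, pairE ψ z ≤ pairE ψ y := by
      have := hy; rw [hψ] at this; exact this.2
    have h1 := small_t (u := y - x) hyP (fun i hi => by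
      have hi' : i ∈ Jset φ c F := by
        by_contra hne
        exact (hys i hne).ne hi
      rw [pairE_sub, hi, hJ i hi']; simp)
    obtain ⟨t, h1, ht⟩ := (h1.and self_mem_nhdsWithin).exists
    have ht : 0 < t := ht
    have h2 := hmax _ h1
    rw [pairE_add, pairE_smul, pairE_sub] at h2
    have h3 : pairE ψ y ≤ pairE ψ x := by
      by_contra hlt
      push Not at hlt
      have := mul_pos ht (sub_pos.mpr hlt)
      linarith
    rw [hψ]
    exact ⟨hx, fun z hz => (hmax z hz).trans h3⟩

theorem faces_finite [Finite ι] : {F | IsFaceOf (HP φ c) F}.Finite := by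
  have : Set.InjOn (fun F => Jset φ c F) {F | IsFaceOf (HP φ c) F} := by
    intro F hF G hG h
    rw [face_eq hF, face_eq hG]
    simp only at h
    rw [h]
  exact Set.Finite.of_finite_image (Set.toFinite _) this

theorem face_extreme {P F : Set (Vd d)} (h : IsFaceOf P F) :
    extremePoints ℝ F = F ∩ extremePoints ℝ P := by
  have : IsExposed ℝ P F := by
    obtain ⟨-, ψ, hψ⟩ := h
    intro _
    exact ⟨innerSL ℝ ψ, hψ⟩
  exact this.isExtreme.extremePoints_eq

/-! ### the cone at a vertex -/

theorem sub_KC (v : Vd d) (F : Set (Vd d)) : F ⊆ KC v F := fun x hx => ⟨1, one_pos, by simpa using hx⟩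

theorem KC_le {v ψ : Vd d} {P : Set (Vd d)} (h : ∀ y ∈ P, pairE ψ y ≤ pairE ψ v) {z : Vd d}
    (hz : z ∈ KC v P) : pairE ψ z ≤ pairE ψ v := by
  obtain ⟨t, ht, hz⟩ := hz
  have := h _ hz
  rw [pairE_add, pairE_smul, pairE_sub] at this
  by_contra hlt
  push Not at hlt
  have := mul_pos ht (sub_pos.mpr hlt)
  linarith

theorem pair_line {v ψ z : Vd d} {t : ℝ} (ht : 0 < t) :
    pairE ψ (v + t • (z - v)) = pairE ψ v ↔ pairE ψ z = pairE ψ v := by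
  rw [pairE_add, pairE_smul, pairE_sub]
  constructor
  · intro h
    have : t * (pairE ψ z - pairE ψ v) = 0 := by linarith
    rcases mul_eq_zero.mp this with h | h
    · exact absurd h ht.ne'
    · linarith
  · intro h; rw [h]; ring

theorem face_val {P F : Set (Vd d)} {v : Vd d} (h : IsFaceOf P F) (hv : v ∈ F) :
    ∃ ψ, (∀ y ∈ P, pairE ψ y ≤ pairE ψ v) ∧ F = {x | x ∈ P ∧ pairE ψ x = pairE ψ v} := by
  obtain ⟨-, ψ, rfl⟩ := h
  refine ⟨ψ, hv.2, ?_⟩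
  ext x
  constructor
  · rintro ⟨hx, h2⟩
    exact ⟨hx, le_antisymm (hv.2 x hx) (h2 v hv.1)⟩
  · rintro ⟨hx, h2⟩
    exact ⟨hx, fun y hy => (hv.2 y hy).trans h2.ge⟩

theorem face_of_val {P F : Set (Vd d)} {v ψ : Vd d} (hv : v ∈ P)
    (h1 : ∀ y ∈ P, pairE ψ y ≤ pairE ψ v) (h2 : F = {x | x ∈ P ∧ pairE ψ x = pairE ψ v}) :
    IsFaceOf P F := by
  subst h2
  refine ⟨⟨v, hv, rfl⟩, ψ, ?_⟩
  ext x
  constructor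
  · rintro ⟨hx, h2⟩
    exact ⟨hx, fun y hy => (h1 y hy).trans h2.ge⟩
  · rintro ⟨hx, h2⟩
    exact ⟨hx, le_antisymm (h1 x hx) (h2 v hv)⟩

theorem KC_val {P : Set (Vd d)} {v ψ : Vd d} :
    KC v {x | x ∈ P ∧ pairE ψ x = pairE ψ v} = {x | x ∈ KC v P ∧ pairE ψ x = pairE ψ v} := by
  ext z
  constructor
  · rintro ⟨t, ht, h1, h2⟩
    exact ⟨⟨t, ht, h1⟩, (pair_line ht).mp h2⟩
  · rintro ⟨⟨t, ht, h1⟩, h2⟩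
    exact ⟨t, ht, h1, (pair_line ht).mpr h2⟩

theorem KC_face {P F : Set (Vd d)} {v : Vd d} (h : IsFaceOf P F) (hv : v ∈ F) :
    IsFaceOf (KC v P) (KC v F) := by
  obtain ⟨ψ, h1, h2⟩ := face_val h hv
  refine face_of_val (sub_KC _ _ (face_sub h hv)) (fun y hy => KC_le h1 hy) ?_
  rw [h2, KC_val]

theorem KC_inter {P F : Set (Vd d)} {v : Vd d} (h : IsFaceOf P F) (hv : v ∈ F) :
    KC v F ∩ P = F := by
  obtain ⟨ψ, h1, h2⟩ := face_val h hv
  rw [h2, KC_val]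
  ext x
  constructor
  · rintro ⟨⟨-, hx⟩, hP⟩; exact ⟨hP, hx⟩
  · rintro ⟨hP, hx⟩; exact ⟨⟨sub_KC _ _ hP, hx⟩, hP⟩

theorem KC_smul {P : Set (Vd d)} {v z : Vd d} (hz : z ∈ KC v P) {r : ℝ} (hr : 0 < r) :
    v + r • (z - v) ∈ KC v P := by
  obtain ⟨t, ht, h⟩ := hz
  refine ⟨t / r, div_pos ht hr, ?_⟩
  convert h using 2
  rw [add_sub_cancel_left, smul_smul, div_mul_cancel₀ _ hr.ne']

theorem face_KC {P G : Set (Vd d)} {v : Vd d} (hv : v ∈ P) (h : IsFaceOf (KC v P) G) :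
    IsFaceOf P (G ∩ P) ∧ v ∈ G ∩ P ∧ KC v (G ∩ P) = G := by
  have hvG : v ∈ G := by
    obtain ⟨⟨z, hz⟩, ψ, rfl⟩ := h
    refine ⟨sub_KC _ _ hv, fun y hy => ?_⟩
    have h1 := hz.2 y hy
    have h2 := hz.2 _ (KC_smul hz.1 (r := 2) two_pos)
    rw [pairE_add, pairE_smul, pairE_sub] at h2
    linarith
  obtain ⟨ψ, h1, h2⟩ := face_val h hvG
  have h3 : G ∩ P = {x | x ∈ P ∧ pairE ψ x = pairE ψ v} := by
    rw [h2]
    ext x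
    constructor
    · rintro ⟨⟨-, hx⟩, hP⟩; exact ⟨hP, hx⟩
    · rintro ⟨hP, hx⟩; exact ⟨⟨sub_KC _ _ hP, hx⟩, hP⟩
  refine ⟨face_of_val hv (fun y hy => h1 y (sub_KC _ _ hy)) h3, ⟨hvG, hv⟩, ?_⟩
  rw [h3, KC_val, ← h2]

theorem KC_bij {P : Set (Vd d)} {v : Vd d} (hv : v ∈ P) :
    Set.BijOn (fun F => KC v F) {F | IsFaceOf P F ∧ v ∈ F} {G | IsFaceOf (KC v P) G} := by
  refine ⟨fun F hF => KC_face hF.1 hF.2, fun F hF G hG h => ?_, fun G hG => ?_⟩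
  · rw [← KC_inter hF.1 hF.2, ← KC_inter hG.1 hG.2]
    simp only at h
    rw [h]
  · obtain ⟨h1, h2, h3⟩ := face_KC hv hG
    exact ⟨G ∩ P, ⟨h1, h2⟩, h3⟩

theorem KC_span {F : Set (Vd d)} {v : Vd d} (hv : v ∈ F) : affineSpan ℝ (KC v F) = affineSpan ℝ F := by
  apply le_antisymm
  · rw [affineSpan_le]
    rintro z ⟨t, ht, h⟩
    have h1 : z = v + t⁻¹ • ((v + t • (z - v)) - v) := by
      rw [add_sub_cancel_left, smul_smul, inv_mul_cancel₀ ht.ne', one_smul]; abel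
    have h2 := AffineSubspace.smul_vsub_vadd_mem (affineSpan ℝ F) t⁻¹ (subset_affineSpan ℝ _ h)
      (subset_affineSpan ℝ _ hv) (subset_affineSpan ℝ _ hv)
    rw [SetLike.mem_coe, h1]
    simpa [add_comm] using h2
  · exact affineSpan_mono ℝ (sub_KC v F)

/-! ### supporting cones -/

theorem extend_pt {F : Set (Vd d)} {x y : Vd d} (hx : x ∈ intrinsicInterior ℝ F) (hy : y ∈ F) :
    ∃ s : ℝ, 0 < s ∧ x + s • (x - y) ∈ F := by
  rw [mem_intrinsicInterior] at hx
  obtain ⟨x', hx', rfl⟩ := hx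
  have hmem : ∀ s : ℝ, (x' : Vd d) + s • ((x' : Vd d) - y) ∈ affineSpan ℝ F := by
    intro s
    have := AffineSubspace.smul_vsub_vadd_mem (affineSpan ℝ F) s x'.2
      (subset_affineSpan ℝ _ hy) x'.2
    simpa [add_comm] using this
  let f : ℝ → affineSpan ℝ F := fun s => ⟨_, hmem s⟩
  have hf : Continuous f := by
    apply Continuous.subtype_mk; fun_prop
  have h0 : f 0 = x' := by ext1; simp [f]
  have h1 : ∀ᶠ s in 𝓝 (0 : ℝ), f s ∈ interior ((↑) ⁻¹' F : Set (affineSpan ℝ F)) := by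
    apply hf.continuousAt.eventually_mem
    rw [h0]; exact isOpen_interior.mem_nhds hx'
  have h2 : ∀ᶠ s in 𝓝[>] (0 : ℝ), f s ∈ interior ((↑) ⁻¹' F : Set (affineSpan ℝ F)) :=
    h1.filter_mono nhdsWithin_le_nhds
  obtain ⟨s, h3, h4⟩ := (h2.and self_mem_nhdsWithin).exists
  have h5 := interior_subset h3
  exact ⟨s, h4, h5⟩

theorem suppCone_HP [Finite ι] {F : Set (Vd d)} (hF : F ⊆ HP φ c) (hc : Convex ℝ F) (hn : F.Nonempty) :
    suppCone (HP φ c) F = {z | ∀ i ∈ Jset φ c F, pairE (φ i) z ≤ c i} := by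
  ext z
  constructor
  · rintro ⟨a, ha, u, ⟨x, hx, ε, hε, h⟩, rfl⟩ i hi
    have hxF : x ∈ F := intrinsicInterior_subset hx
    have ha' : pairE (φ i) a = c i := by
      refine affineSpan_induction (p := fun a => pairE (φ i) a = c i) ha (fun x hx => hi x hx) ?_
      intro r u v w hu hv hw
      simp only [vsub_eq_sub, vadd_eq_add]
      rw [pairE_add, pairE_smul, pairE_sub, hu, hv, hw]; ring
    have h1 := h ε hε le_rfl i
    rw [pairE_add, pairE_smul, hi x hxF] at h1
    have h2 : pairE (φ i) u ≤ 0 := by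
      by_contra hlt
      push Not at hlt
      have := mul_pos hε hlt
      linarith
    rw [pairE_add, ha']; linarith
  · intro hz
    obtain ⟨x, hx⟩ := hn.intrinsicInterior hc
    have hxF : x ∈ F := intrinsicInterior_subset hx
    refine ⟨x, subset_affineSpan ℝ _ hxF, z - x, ⟨x, hx, ?_⟩, by abel⟩
    have h1 := small_t (u := z - x) (hF hxF) (fun i hi => by
      have : i ∈ Jset φ c F := by
        intro y hy
        obtain ⟨s, hs, h⟩ := extend_pt hx hy
        have h1 := hF h i
        rw [pairE_add, pairE_smul, pairE_sub, hi] at h1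
        have h2 := hF hy i
        by_contra hne
        have h3 := lt_of_le_of_ne h2 hne
        have := mul_pos hs (sub_pos.mpr h3)
        linarith
      rw [pairE_sub, hi]
      linarith [hz i this])
    obtain ⟨ε, hε, h⟩ := mem_nhdsGT_iff_exists_Ioc_subset.mp h1
    exact ⟨ε, hε, fun t h0 h1 => h ⟨h0, h1⟩⟩

/-- index type and data presenting a face as a polyhedron. -/
def phiF (φ : ι → Vd d) (J : Set ι) : ι ⊕ J → Vd d := Sum.elim φ (fun j => - φ j)

/-- right-hand sides for a face. -/
def cF {R : Type*} [Neg R] (c : ι → R) (J : Set ι) : ι ⊕ J → R := Sum.elim c (fun j => - c j)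

theorem face_HP [Finite ι] {F : Set (Vd d)} (h : IsFaceOf (HP φ c) F) :
    F = HP (phiF φ (Jset φ c F)) (cF c (Jset φ c F)) := by
  conv_lhs => rw [face_eq h]
  generalize Jset φ c F = J
  ext x
  constructor
  · rintro ⟨h1, h2⟩ (i | j)
    · exact h1 i
    · show pairE (- φ j) x ≤ - c j
      rw [pairE_neg_left, h2 j j.2]
  · intro h1
    have h2 : x ∈ HP φ c := fun i => h1 (Sum.inl i)
    refine ⟨h2, fun i hi => le_antisymm (h2 i) ?_⟩
    have := h1 (Sum.inr ⟨i, hi⟩)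
    change pairE (- φ i) x ≤ - c i at this
    rw [pairE_neg_left] at this
    linarith

theorem suppCone_KC [Finite ι] {F : Set (Vd d)} (h : IsFaceOf (HP φ c) F) {v : Vd d} (hv : v ∈ F) :
    suppCone (KC v (HP φ c)) (KC v F) = suppCone (HP φ c) F := by
  have hvP := face_sub h hv
  have hFc := face_convex HP_convex h
  have hK := KC_face h hv
  rw [suppCone_HP (face_sub h) hFc h.1]
  rw [KC_HP' hvP] at hK ⊢
  rw [suppCone_HP (face_sub hK) (face_convex HP_convex hK) hK.1]
  ext z
  constructor
  · intro hz i hi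
    refine hz ⟨i, hi v hv⟩ ?_
    rintro x ⟨t, ht, hx⟩
    have := hi _ hx
    rw [← hi v hv, pair_line ht] at this
    rw [this, hi v hv]
  · intro hz i hi
    exact hz i fun x hx => hi x (sub_KC v F hx)

end EM
end

noncomputable section
namespace EM
variable {d : ℕ}

variable {ι : Type*} [Finite ι] {φ : ι → Vd d} {c : ι → ℚ}

theorem KC_rat {Λ : AddSubgroup (Vd d)} (hΛ : IsFullLattice Λ) (hφ : ∀ i, IsDualIntegral Λ (φ i))
    {v : Vd d} (hv : v ∈ HP φ (fun i => (c i : ℝ))) :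
    IsRatPolyhedron Λ (KC v (HP φ (fun i => (c i : ℝ)))) := by
  rw [KC_HP' hv]
  exact HP_rat (c := fun i : {i // pairE (φ i) v = (c i : ℝ)} => c i) hΛ (fun i => hφ i)

theorem S_gen {Λ : AddSubgroup (Vd d)} (hΛ : IsFullLattice Λ) (hφ : ∀ i, IsDualIntegral Λ (φ i))
    (hb : Bornology.IsBounded (HP φ (fun i => (c i : ℝ)))) {S : Set (Vd d) → Vd d → ℝ}
    (hS : IsSMap Λ S) :
    Gen (fun ξ => ∫ x in HP φ (fun i => (c i : ℝ)), Real.exp (pairE ξ x) ∂(nuL Λ) =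
      ∑ v ∈ Vx φ (fun i => (c i : ℝ)), S (KC v (HP φ (fun i => (c i : ℝ)))) ξ) := by
  obtain ⟨N, hN, hNX⟩ := common_N (Vx φ (fun i => (c i : ℝ))) (fun x hx => vertex_rat hΛ hφ hx)
  have hd := lat_diff hNX
  refine brion_gen hb (nuL_FB hΛ) hN (fun v hv w hw => nuL_inv (hd v hv w hw))
    (fun v => S (KC v (HP φ (fun i => (c i : ℝ))))) ?_ ?_
  · intro v hv
    exact mero_of_rat (hS.1 _ (KC_rat hΛ hφ (mem_Vx.mp hv).1))
  · intro v hv ξ hitg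
    have hvP := (mem_Vx.mp hv).1
    obtain ⟨h1, h2⟩ := nuL_summable hΛ (KC_meas hvP) (fun x => (Real.exp_pos _).le) hitg
    rw [h2]
    exact hS.2.2 _ (KC_rat hΛ hφ hvP) ξ h1

theorem cF_cast (J : Set ι) : cF (fun i => (c i : ℝ)) J = fun j => ((cF c J j : ℚ) : ℝ) := by
  ext j
  rcases j with j | j
  · rfl
  · show - (c j : ℝ) = ((- c j : ℚ) : ℝ)
    push_cast; rfl

theorem phiF_DI {Λ : AddSubgroup (Vd d)} (hφ : ∀ i, IsDualIntegral Λ (φ i)) (J : Set ι) (j) :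
    IsDualIntegral Λ (phiF φ J j) := by
  rcases j with j | j
  · exact hφ j
  · intro x hx
    obtain ⟨n, hn⟩ := hφ j x hx
    refine ⟨-n, ?_⟩
    show pairE (- φ j) x = _
    rw [pairE_neg_left, hn]; push_cast; rfl

open Classical in
theorem I_gen {Λ : AddSubgroup (Vd d)} (hΛ : IsFullLattice Λ) (hφ : ∀ i, IsDualIntegral Λ (φ i))
    (hb : Bornology.IsBounded (HP φ (fun i => (c i : ℝ)))) {I : Set (Vd d) → Vd d → ℝ}
    (hI : IsIMap Λ I) {F : Set (Vd d)} (hF : IsFaceOf (HP φ (fun i => (c i : ℝ))) F)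
    {m : Measure (Vd d)}
    (hm : IsCanonicalMeasure Λ ((affineSpan ℝ F : AffineSubspace ℝ (Vd d)) : Set (Vd d)) m) :
    Gen (fun ξ => ∫ x in F, Real.exp (pairE ξ x) ∂m =
      ∑ v ∈ (Vx φ (fun i => (c i : ℝ))).filter (· ∈ F), I (KC v F) ξ) := by
  have hFe := face_HP hF
  rw [cF_cast] at hFe
  generalize hφ' : phiF φ (Jset φ (fun i => (c i : ℝ)) F) = φ' at hFe
  generalize hc' : cF c (Jset φ (fun i => (c i : ℝ)) F) = c' at hFe
  have hDI : ∀ j, IsDualIntegral Λ (φ' j) := by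
    intro j; rw [← hφ']; exact phiF_DI hφ _ j
  have hX : (Vx φ (fun i => (c i : ℝ))).filter (· ∈ F) = Vx φ' (fun j => (c' j : ℝ)) := by
    ext v
    rw [Finset.mem_filter, mem_Vx, mem_Vx, ← hFe, face_extreme hF]
    exact and_comm
  rw [hX]
  have hbF : Bornology.IsBounded (HP φ' (fun j => (c' j : ℝ))) := by
    rw [← hFe]; exact hb.subset (face_sub hF)
  have hvF : ∀ v ∈ Vx φ' (fun j => (c' j : ℝ)), v ∈ F := by
    intro v hv
    rw [← hX] at hv; exact (Finset.mem_filter.mp hv).2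
  have hKC : ∀ v, KC v (HP φ' (fun j => (c' j : ℝ))) = KC v F := fun v => by rw [← hFe]
  have hrat : ∀ v ∈ Vx φ' (fun j => (c' j : ℝ)), IsRatPolyhedron Λ (KC v F) := by
    intro v hv
    rw [← hKC]; exact KC_rat hΛ hDI (mem_Vx.mp hv).1
  have := brion_gen hbF (canon_FB hm) one_pos (fun v hv w hw =>
      canon_inv hm (subset_affineSpan ℝ F (hvF v hv)) (subset_affineSpan ℝ F (hvF w hw)) _)
    (fun v => I (KC v F)) (fun v hv => mero_of_rat (hI.1 _ (hrat v hv)))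
    (fun v hv ξ hitg => by
      rw [hKC] at hitg ⊢
      refine hI.2.2 _ (hrat v hv) m ?_ ξ hitg
      rw [KC_span (hvF v hv)]; exact hm)
  rw [← hFe] at this
  exact this

open Classical in
theorem mu_gen {Λ : AddSubgroup (Vd d)} (hΛ : IsFullLattice Λ) (hφ : ∀ i, IsDualIntegral Λ (φ i))
    (hb : Bornology.IsBounded (HP φ (fun i => (c i : ℝ))))
    {Q : Vd d →ₗ[ℝ] Vd d →ₗ[ℝ] ℝ} {I S μ : AddSubgroup (Vd d) → Set (Vd d) → Vd d → ℝ}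
    (hμ : IsMuCore Λ Q I S μ)
    (π : Set (Vd d) → (Vd d →ₗ[ℝ] Vd d))
    (hπ : ∀ F, IsFaceOf (HP φ (fun i => (c i : ℝ))) F → IsQCoproj Q (affineSpan ℝ F).direction (π F))
    {v : Vd d} (hv : v ∈ Vx φ (fun i => (c i : ℝ))) :
    Gen (fun ξ => S Λ (KC v (HP φ (fun i => (c i : ℝ)))) ξ =
      ∑ F ∈ (faces_finite (φ := φ) (c := fun i => (c i : ℝ))).toFinset.filter (v ∈ ·),
        μ (AddSubgroup.map (π F).toAddMonoidHom Λ)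
          ((π F) '' suppCone (HP φ (fun i => (c i : ℝ))) F) ξ * I Λ (KC v F) ξ) := by
  set P := HP φ (fun i => (c i : ℝ)) with hP
  have hvP : v ∈ P := (mem_Vx.mp hv).1
  have h := hμ.2.2 Λ (quot_self Q Λ) (KC v P) (KC_cone hΛ hφ hb hv) (KC_no_line hv)
    (fun G => π (G ∩ P)) (fun G hG => by
      obtain ⟨h1, h2, h3⟩ := face_KC hvP hG
      have := hπ _ h1
      rw [← KC_span h2, h3] at this
      exact this)
  refine Gen.mono (p := fun ξ => S Λ (KC v P) ξ = _) h ?_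
  intro ξ hξ
  rw [hξ]
  rw [← finsum_mem_eq_of_bijOn (fun F => KC v F) (KC_bij hvP)
    (f := fun F => μ (AddSubgroup.map (π F).toAddMonoidHom Λ) ((π F) '' suppCone P F) ξ
      * I Λ (KC v F) ξ)]
  · have : {F | IsFaceOf P F ∧ v ∈ F} = 
        (((faces_finite (φ := φ) (c := fun i => (c i : ℝ))).toFinset.filter (v ∈ ·) :
          Finset (Set (Vd d))) : Set (Set (Vd d))) := by
      ext F; simp [hP]
    rw [this, finsum_mem_coe_finset]
  · intro F hF
    beta_reduce
    rw [KC_inter hF.1 hF.2, suppCone_KC hF.1 hF.2]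

theorem lap_ind (ν : Measure (Vd d)) {F : Set (Vd d)} (hF : MeasurableSet F) (ξ : Vd d) :
    lap ν (ind F) ξ = ∫ x in F, Real.exp (pairE ξ x) ∂ν := by
  unfold lap
  rw [ind_mul, integral_indicator hF]

theorem face_closed {F : Set (Vd d)} {c : ι → ℝ} (h : IsFaceOf (HP φ c) F) : MeasurableSet F := by
  rw [face_HP h]; exact HP_closed.measurableSet

theorem exp_identity {Λ : AddSubgroup (Vd d)} (hΛ : IsFullLattice Λ)
    (hφ : ∀ i, IsDualIntegral Λ (φ i))
    (hb : Bornology.IsBounded (HP φ (fun i => (c i : ℝ))))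
    {Q : Vd d →ₗ[ℝ] Vd d →ₗ[ℝ] ℝ} {I S μ : AddSubgroup (Vd d) → Set (Vd d) → Vd d → ℝ}
    (hI : IsIMap Λ (I Λ)) (hS : IsSMap Λ (S Λ)) (hμ : IsMuCore Λ Q I S μ)
    (π : Set (Vd d) → (Vd d →ₗ[ℝ] Vd d))
    (hπ : ∀ F, IsFaceOf (HP φ (fun i => (c i : ℝ))) F → IsQCoproj Q (affineSpan ℝ F).direction (π F))
    (m : Set (Vd d) → Measure (Vd d))
    (hm : ∀ F, IsFaceOf (HP φ (fun i => (c i : ℝ))) F →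
      IsCanonicalMeasure Λ ((affineSpan ℝ F : AffineSubspace ℝ (Vd d)) : Set (Vd d)) (m F))
    (hser : ∀ F, IsFaceOf (HP φ (fun i => (c i : ℝ))) F →
      AnalyticAt ℝ (μ (AddSubgroup.map (π F).toAddMonoidHom Λ)
          ((π F) '' suppCone (HP φ (fun i => (c i : ℝ))) F)) 0) :
    ∀ᶠ ξ in 𝓝 (0 : Vd d), lap (nuL Λ) (ind (HP φ (fun i => (c i : ℝ)))) ξ =
      ∑ F ∈ (faces_finite (φ := φ) (c := fun i => (c i : ℝ))).toFinset,
        μ (AddSubgroup.map (π F).toAddMonoidHom Λ)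
          ((π F) '' suppCone (HP φ (fun i => (c i : ℝ))) F) ξ * lap (m F) (ind F) ξ := by
  classical
  set P := HP φ (fun i => (c i : ℝ)) with hP
  set Fs := (faces_finite (φ := φ) (c := fun i => (c i : ℝ))).toFinset with hFs
  have hmF : ∀ F, F ∈ Fs ↔ IsFaceOf P F := by intro F; simp [hFs, hP]
  obtain ⟨R, hR⟩ := hb.subset_closedBall 0
  have hPm : MeasurableSet P := HP_closed.measurableSet
  have hnF : ∀ F ∈ Fs, Nice (ind F) R := fun F hF =>
    ind_nice (face_closed ((hmF F).mp hF)) ((face_sub ((hmF F).mp hF)).trans hR)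
  refine Gen.eq_of_cont ?_ ?_ ?_
  · have g1 := S_gen hΛ hφ hb hS
    have g2 := Gen.all (Vx φ (fun i => (c i : ℝ))) (fun v hv => mu_gen hΛ hφ hb hμ π hπ hv)
    have g3 := Gen.all Fs (fun F hF => I_gen hΛ hφ hb hI ((hmF F).mp hF) (hm F ((hmF F).mp hF)))
    refine ((g1.and g2).and g3).mono ?_
    rintro ξ ⟨⟨h1, h2⟩, h3⟩
    rw [lap_ind _ hPm, h1, Finset.sum_congr rfl h2]
    have h4 : ∀ F ∈ Fs, lap (m F) (ind F) ξ =
        ∑ v ∈ (Vx φ (fun i => (c i : ℝ))).filter (· ∈ F), I Λ (KC v F) ξ := by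
      intro F hF
      rw [lap_ind _ (face_closed ((hmF F).mp hF)), h3 F hF]
    have h5 : ∑ F ∈ Fs, μ (AddSubgroup.map (π F).toAddMonoidHom Λ) ((π F) '' suppCone P F) ξ
          * lap (m F) (ind F) ξ =
        ∑ F ∈ Fs, ∑ v ∈ Vx φ (fun i => (c i : ℝ)), if v ∈ F then
          μ (AddSubgroup.map (π F).toAddMonoidHom Λ) ((π F) '' suppCone P F) ξ
          * I Λ (KC v F) ξ else 0 := by
      refine Finset.sum_congr rfl (fun F hF => ?_)
      rw [h4 F hF, Finset.mul_sum, Finset.sum_filter]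
    rw [h5, Finset.sum_comm]
    refine Finset.sum_congr rfl (fun v _ => ?_)
    rw [Finset.sum_filter]
  · exact Eventually.of_forall fun ξ => (lap_analytic (nuL_FB hΛ) (ind_nice hPm hR) ξ).continuousAt
  · have : ∀ᶠ ξ in 𝓝 (0 : Vd d), ∀ F ∈ Fs, AnalyticAt ℝ
        (μ (AddSubgroup.map (π F).toAddMonoidHom Λ) ((π F) '' suppCone P F)) ξ := by
      rw [eventually_all_finset]
      intro F hF
      exact (hser F ((hmF F).mp hF)).eventually_analyticAt
    filter_upwards [this] with ξ hξ
    refine (Finset.analyticAt_fun_sum Fs fun F hF => (hξ F hF).mul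
      (lap_analytic (canon_FB (hm F ((hmF F).mp hF))) (hnF F hF) ξ)).continuousAt

end EM
end

noncomputable section
namespace EM
variable {d : ℕ}

/-- the one-variable power series with given coefficients. -/
def serA (a : ℕ → ℝ) : FormalMultilinearSeries ℝ ℝ ℝ :=
  fun n => ContinuousMultilinearMap.mkPiRing ℝ (Fin n) (a n)

theorem serA_coeff (a : ℕ → ℝ) (n : ℕ) : (serA a).coeff n = a n := by
  simp [FormalMultilinearSeries.coeff, serA]

theorem ser_of_hasSum {a : ℕ → ℝ} {A : ℝ → ℝ} (h : ∀ᶠ s in 𝓝 (0 : ℝ), HasSum (fun k => a k * s ^ k) (A s)) :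
    HasFPowerSeriesAt A (serA a) 0 := by
  refine hasFPowerSeriesAt_iff.mpr ?_
  filter_upwards [h] with s hs
  have e : (fun n : ℕ => s ^ n • (serA a).coeff n) = fun k => a k * s ^ k := by
    funext n
    rw [serA_coeff, smul_eq_mul, mul_comm]
  rw [zero_add]
  exact e ▸ hs

theorem coef_unique {a b : ℕ → ℝ} {A : ℝ → ℝ}
    (ha : ∀ᶠ s in 𝓝 (0 : ℝ), HasSum (fun k => a k * s ^ k) (A s))
    (hb : ∀ᶠ s in 𝓝 (0 : ℝ), HasSum (fun k => b k * s ^ k) (A s)) (k : ℕ) : a k = b k := by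
  have := (ser_of_hasSum ha).eq_formalMultilinearSeries (ser_of_hasSum hb)
  rw [← serA_coeff a, ← serA_coeff b, this]

theorem cauchy {a b : ℕ → ℝ} {A B s : ℝ} (ha : HasSum (fun k => a k * s ^ k) A)
    (hb : HasSum (fun k => b k * s ^ k) B) :
    HasSum (fun k => (∑ n ∈ Finset.range (k + 1), a n * b (k - n)) * s ^ k) (A * B) := by
  have ha' : Summable (fun k => ‖a k * s ^ k‖) := ha.summable.norm
  have hb' : Summable (fun k => ‖b k * s ^ k‖) := hb.summable.norm
  have h := hasSum_sum_range_mul_of_summable_norm ha' hb'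
  rw [ha.tsum_eq, hb.tsum_eq] at h
  refine h.congr_fun ?_
  intro k
  rw [Finset.sum_mul]
  refine Finset.sum_congr rfl fun n hn => ?_
  have : n + (k - n) = k := by have := Finset.mem_range.mp hn; omega
  rw [← this, pow_add, this]; ring

theorem coef_id {β : Type*} (T : Finset β) {a b : β → ℕ → ℝ} {A B : β → ℝ → ℝ} {u : ℕ → ℝ} {U : ℝ → ℝ}
    (hU : ∀ s, HasSum (fun k => u k * s ^ k) (U s))
    (hA : ∀ F ∈ T, ∀ᶠ s in 𝓝 (0 : ℝ), HasSum (fun k => a F k * s ^ k) (A F s))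
    (hB : ∀ F ∈ T, ∀ s, HasSum (fun k => b F k * s ^ k) (B F s))
    (h : ∀ᶠ s in 𝓝 (0 : ℝ), U s = ∑ F ∈ T, A F s * B F s) (k : ℕ) :
    u k = ∑ F ∈ T, ∑ n ∈ Finset.range (k + 1), a F n * b F (k - n) := by
  refine coef_unique (A := U) (Eventually.of_forall hU) (b := fun k => ∑ F ∈ T, ∑ n ∈ Finset.range (k + 1), a F n * b F (k - n)) ?_ k
  filter_upwards [h, (eventually_all_finset T).mpr hA] with s hs h2
  rw [hs]
  have := hasSum_sum (fun F hF => cauchy (h2 F hF) (hB F hF s))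
  convert this using 2 with k
  rw [Finset.sum_mul]

theorem ser_line {g : Vd d → ℝ} {p : FormalMultilinearSeries ℝ (Vd d) ℝ} (h : HasFPowerSeriesAt g p 0)
    (ζ : Vd d) : ∀ᶠ s in 𝓝 (0 : ℝ), HasSum (fun n => p n (fun _ => ζ) * s ^ n) (g (s • ζ)) := by
  have h1 := h.eventually_hasSum
  have h2 : Tendsto (fun s : ℝ => s • ζ) (𝓝 0) (𝓝 (0 : Vd d)) := by
    have : Continuous (fun s : ℝ => s • ζ) := by fun_prop
    simpa using this.tendsto 0
  filter_upwards [h2.eventually h1] with s hs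
  rw [zero_add] at hs
  refine hs.congr_fun ?_
  intro n
  have := (p n).map_smul_univ (fun _ => s) (fun _ => ζ)
  simp at this
  rw [this, mul_comm]

theorem coe_pairE (ζ : Vd d) : (fun x => pairE ζ x) = ⇑(innerSL ℝ ζ) := by
  ext x; simp [pairE]

theorem pw_contDiff (ζ : Vd d) (k : ℕ) : ContDiff ℝ ⊤ (fun x : Vd d => pairE ζ x ^ k) := by
  refine ContDiff.pow (f := fun x => pairE ζ x) ?_ k
  rw [coe_pairE]; exact (innerSL ℝ ζ).contDiff

theorem pw_iter (ζ : Vd d) (k n : ℕ) (x : Vd d) (v : Fin n → Vd d) :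
    iteratedFDeriv ℝ n (fun x : Vd d => pairE ζ x ^ k) x v =
      (k.descFactorial n : ℝ) * pairE ζ x ^ (k - n) * ∏ i, pairE ζ (v i) := by
  have : (fun x : Vd d => pairE ζ x ^ k) = (fun t : ℝ => t ^ k) ∘ (innerSL ℝ ζ) := by
    ext x; simp [pairE]
  rw [this, ContinuousLinearMap.iteratedFDeriv_comp_right (innerSL ℝ ζ) (f := fun t : ℝ => t ^ k) (n := ⊤) (contDiff_id.pow k) x le_top]
  rw [ContinuousMultilinearMap.compContinuousLinearMap_apply,
    iteratedFDeriv_apply_eq_iteratedDeriv_mul_prod, iteratedDeriv_eq_iterate, iter_deriv_pow]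
  have hp : (k.descFactorial n : ℝ) = ∏ i ∈ Finset.range n, ((k : ℝ) - i) := by
    rw [← descPochhammer_eval_eq_descFactorial, descPochhammer_eval_eq_prod_range]
  rw [hp]
  simp [pairE]
  ring

theorem multiPair_pw (ζ : Vd d) {n : ℕ} (p q : ContinuousMultilinearMap ℝ (fun _ : Fin n => Vd d) ℝ)
    (C : ℝ) (hq : ∀ v, q v = C * ∏ i, pairE ζ (v i)) : multiPair p q = C * p (fun _ => ζ) := by
  have hζ : ζ = ∑ i, pairE ζ ((EuclideanSpace.basisFun (Fin d) ℝ) i) •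
      (EuclideanSpace.basisFun (Fin d) ℝ) i := by
    conv_lhs => rw [← (EuclideanSpace.basisFun (Fin d) ℝ).sum_repr' ζ]
    refine Finset.sum_congr rfl fun i _ => ?_
    rw [pairE_comm]; rfl
  have h2 : p (fun _ => ζ) = p (fun _ => ∑ i, pairE ζ ((EuclideanSpace.basisFun (Fin d) ℝ) i) •
      (EuclideanSpace.basisFun (Fin d) ℝ) i) := by rw [← hζ]
  rw [h2, p.map_sum, Finset.mul_sum]
  unfold multiPair
  refine Finset.sum_congr rfl fun ι _ => ?_
  rw [hq, p.map_smul_univ, smul_eq_mul]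
  ring

theorem DOp_range {p : FormalMultilinearSeries ℝ (Vd d) ℝ} {h : Vd d → ℝ} {N : ℕ}
    (hN : ∀ n, N ≤ n → ∀ x, iteratedFDeriv ℝ n h x = 0) (x : Vd d) :
    DOp p h x = ∑ n ∈ Finset.range N, multiPair (p n) (iteratedFDeriv ℝ n h x) := by
  unfold DOp
  rw [finsum_eq_sum_of_support_subset]
  intro n hn
  rw [Finset.coe_range, Set.mem_Iio]
  by_contra hc
  apply hn
  simp only
  rw [hN n (not_lt.mp hc)]
  simp [multiPair]

theorem pw_fin (ζ : Vd d) (k : ℕ) : ∀ n, k + 1 ≤ n → ∀ x,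
    iteratedFDeriv ℝ n (fun x : Vd d => pairE ζ x ^ k) x = 0 := by
  intro n hn x
  ext v
  rw [pw_iter, Nat.descFactorial_of_lt (by omega)]
  simp

theorem DOp_pw (p : FormalMultilinearSeries ℝ (Vd d) ℝ) (ζ : Vd d) (k : ℕ) (x : Vd d) :
    DOp p (fun x : Vd d => pairE ζ x ^ k) x = ∑ n ∈ Finset.range (k + 1),
      (k.descFactorial n : ℝ) * pairE ζ x ^ (k - n) * p n (fun _ => ζ) := by
  rw [DOp_range (pw_fin ζ k)]
  refine Finset.sum_congr rfl fun n _ => ?_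
  exact multiPair_pw ζ _ _ _ (pw_iter ζ k n x)

/-- good functions: smooth with finitely many nonzero derivatives. -/
def Fin0 (h : Vd d → ℝ) : Prop :=
  ContDiff ℝ ⊤ h ∧ ∃ N : ℕ, ∀ n, N ≤ n → ∀ x, iteratedFDeriv ℝ n h x = 0

theorem iter_cd {h : Vd d → ℝ} (hh : ContDiff ℝ ⊤ h) (n : ℕ) : ContDiff ℝ n h :=
  hh.of_le le_top

theorem Fin0.cont {h : Vd d → ℝ} (hh : Fin0 h) (p : FormalMultilinearSeries ℝ (Vd d) ℝ) :
    Continuous (fun x => DOp p h x) := by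
  obtain ⟨h1, N, h2⟩ := hh
  have : (fun x => DOp p h x) = fun x => ∑ n ∈ Finset.range N, multiPair (p n) (iteratedFDeriv ℝ n h x) :=
    funext fun x => DOp_range h2 x
  rw [this]
  refine continuous_finsetSum _ fun n _ => ?_
  unfold multiPair
  refine continuous_finsetSum _ fun ι _ => ?_
  refine continuous_const.mul ?_
  have := (iter_cd h1 n).continuous_iteratedFDeriv (m := n) le_rfl
  exact (ContinuousMultilinearMap.apply ℝ (fun _ : Fin n => Vd d) ℝ _).continuous.comp this

theorem Fin0.add {h g : Vd d → ℝ} (hh : Fin0 h) (hg : Fin0 g) : Fin0 (h + g) ∧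
    ∀ p : FormalMultilinearSeries ℝ (Vd d) ℝ, ∀ x, DOp p (h + g) x = DOp p h x + DOp p g x := by
  obtain ⟨h1, N, h2⟩ := hh
  obtain ⟨g1, M, g2⟩ := hg
  have ha : ∀ n x, iteratedFDeriv ℝ n (h + g) x = iteratedFDeriv ℝ n h x + iteratedFDeriv ℝ n g x :=
    fun n x => iteratedFDeriv_add_apply (iter_cd h1 n).contDiffAt (iter_cd g1 n).contDiffAt
  have h3 : ∀ n, max N M ≤ n → ∀ x, iteratedFDeriv ℝ n (h + g) x = 0 := by
    intro n hn x
    rw [ha, h2 n (by omega), g2 n (by omega), add_zero]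
  refine ⟨⟨h1.add g1, max N M, h3⟩, fun p x => ?_⟩
  rw [DOp_range h3, DOp_range (N := max N M) (fun n hn => h2 n (by omega)),
    DOp_range (N := max N M) (fun n hn => g2 n (by omega)), ← Finset.sum_add_distrib]
  refine Finset.sum_congr rfl fun n _ => ?_
  unfold multiPair
  rw [← Finset.sum_add_distrib]
  refine Finset.sum_congr rfl fun ι _ => ?_
  rw [ha, add_apply, mul_add]

theorem Fin0.smul {h : Vd d → ℝ} (hh : Fin0 h) (a : ℝ) : Fin0 (a • h) ∧
    ∀ p : FormalMultilinearSeries ℝ (Vd d) ℝ, ∀ x, DOp p (a • h) x = a * DOp p h x := by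
  obtain ⟨h1, N, h2⟩ := hh
  have ha : ∀ n x, iteratedFDeriv ℝ n (a • h) x = a • iteratedFDeriv ℝ n h x :=
    fun n x => iteratedFDeriv_const_smul_apply (iter_cd h1 n).contDiffAt
  have h3 : ∀ n, N ≤ n → ∀ x, iteratedFDeriv ℝ n (a • h) x = 0 := by
    intro n hn x
    rw [ha, h2 n hn, smul_zero]
  refine ⟨⟨contDiff_const.smul h1, N, h3⟩, fun p x => ?_⟩
  rw [DOp_range h3, DOp_range h2, Finset.mul_sum]
  refine Finset.sum_congr rfl fun n _ => ?_
  unfold multiPair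
  rw [Finset.mul_sum]
  refine Finset.sum_congr rfl fun ι _ => ?_
  rw [ha, smul_apply, smul_eq_mul]; ring

/-- the linear form with coefficients `ζ`, as a polynomial. -/
def linP (ζ : Fin d → ℝ) : MvPolynomial (Fin d) ℝ := ∑ i, MvPolynomial.C (ζ i) * MvPolynomial.X i

theorem linP_pow (ζ : Fin d → ℝ) (n : ℕ) : linP ζ ^ n =
    ∑ k ∈ Finset.piAntidiag Finset.univ n,
      ((Nat.multinomial Finset.univ k : ℝ) * ∏ i, ζ i ^ k i) •
        (∏ i, (MvPolynomial.X i : MvPolynomial (Fin d) ℝ) ^ k i) := by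
  unfold linP
  rw [Finset.sum_pow_eq_sum_piAntidiag]
  refine Finset.sum_congr rfl fun k _ => ?_
  simp only [mul_pow, Finset.prod_mul_distrib, MvPolynomial.smul_eq_C_mul, map_mul, map_prod, map_pow,
    map_natCast]
  ring

theorem span_pow : Submodule.span ℝ {q : MvPolynomial (Fin d) ℝ | ∃ ζ n, q = linP ζ ^ n} = ⊤ := by
  by_contra hne
  obtain ⟨f, hf, hle⟩ := Submodule.exists_le_ker_of_lt_top _ (lt_top_iff_ne_top.mpr hne)
  apply hf
  have key : ∀ k : Fin d → ℕ, f (∏ i, (MvPolynomial.X i : MvPolynomial (Fin d) ℝ) ^ k i) = 0 := by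
    intro k₀
    set n := ∑ i, k₀ i with hn
    let q : MvPolynomial (Fin d) ℝ := ∑ k ∈ Finset.piAntidiag Finset.univ n,
      MvPolynomial.monomial (Finsupp.equivFunOnFinite.symm k)
        ((Nat.multinomial Finset.univ k : ℝ) * f (∏ i, (MvPolynomial.X i : MvPolynomial (Fin d) ℝ) ^ k i))
    have hq : q = 0 := by
      apply MvPolynomial.funext
      intro ζ
      have h1 : f (linP ζ ^ n) = 0 := hle (Submodule.subset_span ⟨ζ, n, rfl⟩)
      rw [linP_pow, map_sum] at h1
      rw [map_zero, ← h1]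
      simp only [q, map_sum]
      refine Finset.sum_congr rfl fun k _ => ?_
      rw [MvPolynomial.eval_monomial, Finsupp.prod_fintype _ _ (by simp), map_smul, smul_eq_mul]
      simp only [Finsupp.equivFunOnFinite_symm_apply_apply]
      ring
    have h2 := congrArg (MvPolynomial.coeff (Finsupp.equivFunOnFinite.symm k₀)) hq
    simp only [q, MvPolynomial.coeff_sum, MvPolynomial.coeff_monomial, MvPolynomial.coeff_zero] at h2
    rw [Finset.sum_eq_single k₀] at h2
    · rw [if_pos rfl] at h2
      refine (mul_eq_zero.mp h2).resolve_left ?_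
      have := Nat.multinomial_pos Finset.univ k₀
      positivity
    · intro b _ hb
      rw [if_neg]
      intro hc
      exact hb (Finsupp.equivFunOnFinite.symm.injective hc)
    · intro hc
      exfalso; apply hc
      simp [Finset.mem_piAntidiag, hn]
  apply MvPolynomial.linearMap_ext
  intro s
  apply LinearMap.ext_ring
  have : (MvPolynomial.monomial s (1 : ℝ)) = ∏ i, (MvPolynomial.X i : MvPolynomial (Fin d) ℝ) ^ s i := by
    rw [MvPolynomial.monomial_eq, Finsupp.prod_fintype _ _ (by simp)]; simp
  simp only [LinearMap.comp_apply, LinearMap.zero_apply]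
  rw [this]; exact key s

theorem linP_eval (ζ : Fin d → ℝ) (x : Vd d) :
    MvPolynomial.eval (fun i => x i) (linP ζ) = pairE (WithLp.toLp 2 ζ) x := by
  unfold linP pairE
  simp [PiLp.inner_apply, mul_comm]

/-- extension from powers of linear forms to all polynomials. -/
theorem poly_ind {β : Type*} (T : Finset β) (ν : Measure (Vd d)) (hν : FB ν) (m : β → Measure (Vd d))
    (hm : ∀ F ∈ T, FB (m F)) (g : Vd d → ℝ) (gF : β → Vd d → ℝ) {R : ℝ} (hg : Nice g R)
    (hgF : ∀ F ∈ T, Nice (gF F) R) (ser : β → FormalMultilinearSeries ℝ (Vd d) ℝ)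
    (hpw : ∀ ζ k, ∫ x, g x * pairE ζ x ^ k ∂ν =
      ∑ F ∈ T, ∫ x, gF F x * DOp (ser F) (fun x => pairE ζ x ^ k) x ∂(m F))
    (p : MvPolynomial (Fin d) ℝ) :
    ∫ x, g x * MvPolynomial.eval (fun i => x i) p ∂ν =
      ∑ F ∈ T, ∫ x, gF F x * DOp (ser F) (fun x : Vd d => MvPolynomial.eval (fun i => x i) p) x ∂(m F) := by
  have hp : p ∈ Submodule.span ℝ {q : MvPolynomial (Fin d) ℝ | ∃ ζ n, q = linP ζ ^ n} := by
    rw [span_pow]; trivial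
  suffices h : Fin0 (fun x : Vd d => MvPolynomial.eval (fun i => x i) p) ∧ 
    ∫ x, g x * MvPolynomial.eval (fun i => x i) p ∂ν =
      ∑ F ∈ T, ∫ x, gF F x * DOp (ser F) (fun x : Vd d => MvPolynomial.eval (fun i => x i) p) x ∂(m F)
    from h.2
  have ex : ∀ p q : MvPolynomial (Fin d) ℝ, (fun x : Vd d => MvPolynomial.eval (fun i => x i) (p + q)) =
    (fun x : Vd d => MvPolynomial.eval (fun i => x i) p) + (fun x : Vd d => MvPolynomial.eval (fun i => x i) q) := by
    intro p q; ext x; simp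
  have es : ∀ (a : ℝ) (p : MvPolynomial (Fin d) ℝ), (fun x : Vd d => MvPolynomial.eval (fun i => x i) (a • p)) =
    a • (fun x : Vd d => MvPolynomial.eval (fun i => x i) p) := by
    intro a p; ext x; simp [MvPolynomial.smul_eval]
  have e0 : (fun x : Vd d => MvPolynomial.eval (fun i => x i) (0 : MvPolynomial (Fin d) ℝ)) =
      fun _ => 0 := by ext; simp
  induction hp using Submodule.span_induction with
  | mem q hq =>
    obtain ⟨ζ, n, rfl⟩ := hq
    have : (fun x : Vd d => MvPolynomial.eval (fun i => x i) (linP ζ ^ n)) =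
        fun x => pairE (WithLp.toLp 2 ζ) x ^ n := by
      ext x; rw [map_pow, linP_eval]
    rw [this]
    refine ⟨⟨pw_contDiff _ _, _, pw_fin _ _⟩, ?_⟩
    simp only [map_pow, linP_eval]
    exact hpw _ _
  | zero =>
    rw [e0]
    have z : ∀ (n : ℕ) (x : Vd d), iteratedFDeriv ℝ n (fun _ : Vd d => (0 : ℝ)) x = 0 := by
      intro n x; simp [iteratedFDeriv_fun_zero]
    have z2 : ∀ (p : FormalMultilinearSeries ℝ (Vd d) ℝ) (x : Vd d), DOp p (fun _ => (0 : ℝ)) x = 0 := by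
      intro p x
      rw [DOp_range (N := 0) (fun n _ => z n)]; simp
    refine ⟨⟨contDiff_const, 0, fun n _ => z n⟩, ?_⟩
    simp [z2]
  | add p q _ _ hp hq =>
    rw [ex]
    obtain ⟨hp1, hp2⟩ := hp
    obtain ⟨hq1, hq2⟩ := hq
    obtain ⟨h1, h2⟩ := hp1.add hq1
    refine ⟨h1, ?_⟩
    simp only [map_add, mul_add, h2]
    rw [integral_add (nice_integrable hν hg hp1.1.continuous) (nice_integrable hν hg hq1.1.continuous),
      hp2, hq2, ← Finset.sum_add_distrib]
    refine Finset.sum_congr rfl fun F hF => ?_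
    rw [integral_add (nice_integrable (hm F hF) (hgF F hF) (hp1.cont _))
      (nice_integrable (hm F hF) (hgF F hF) (hq1.cont _))]
  | smul a p _ hp =>
    rw [es]
    obtain ⟨hp1, hp2⟩ := hp
    obtain ⟨h1, h2⟩ := hp1.smul a
    refine ⟨h1, ?_⟩
    simp only [MvPolynomial.smul_eval, h2, mul_left_comm _ a, integral_const_mul]
    rw [hp2, Finset.mul_sum]

/-- from the exponential identity to powers of linear forms. -/
theorem pw_of_exp {β : Type*} (T : Finset β) (ν : Measure (Vd d)) (hν : FB ν) (m : β → Measure (Vd d))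
    (hm : ∀ F ∈ T, FB (m F)) (g : Vd d → ℝ) (gF : β → Vd d → ℝ) {R : ℝ} (hg : Nice g R)
    (hgF : ∀ F ∈ T, Nice (gF F) R) (ser : β → FormalMultilinearSeries ℝ (Vd d) ℝ)
    (M : β → Vd d → ℝ) (hser : ∀ F ∈ T, HasFPowerSeriesAt (M F) (ser F) 0)
    (hexp : ∀ᶠ ξ in 𝓝 (0 : Vd d), lap ν g ξ = ∑ F ∈ T, M F ξ * lap (m F) (gF F) ξ)
    (ζ : Vd d) (k : ℕ) : ∫ x, g x * pairE ζ x ^ k ∂ν =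
      ∑ F ∈ T, ∫ x, gF F x * DOp (ser F) (fun x => pairE ζ x ^ k) x ∂(m F) := by
  have h2 : Tendsto (fun s : ℝ => s • ζ) (𝓝 0) (𝓝 (0 : Vd d)) := by
    have : Continuous (fun s : ℝ => s • ζ) := by fun_prop
    simpa using this.tendsto 0
  have h := coef_id T (lap_hasSum hν hg ζ) (fun F hF => ser_line (hser F hF) ζ)
    (fun F hF => lap_hasSum (hm F hF) (hgF F hF) ζ) (h2.eventually hexp) k
  have hk : (k.factorial : ℝ) ≠ 0 := by positivity
  have h3 : ∫ x, g x * pairE ζ x ^ k ∂ν = (k.factorial : ℝ) *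
      ((k.factorial : ℝ)⁻¹ * ∫ x, g x * pairE ζ x ^ k ∂ν) := by field_simp
  rw [h3, h, Finset.mul_sum]
  refine Finset.sum_congr rfl fun F hF => ?_
  simp only [DOp_pw, Finset.mul_sum]
  rw [integral_finsetSum]
  · refine Finset.sum_congr rfl fun n hn => ?_
    have hnk : n ≤ k := by have := Finset.mem_range.mp hn; omega
    have e : ∀ x, gF F x * ((k.descFactorial n : ℝ) * pairE ζ x ^ (k - n) * (ser F n) fun _ => ζ) =
      ((k.descFactorial n : ℝ) * (ser F n) fun _ => ζ) * (gF F x * pairE ζ x ^ (k - n)) := by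
      intro x; ring
    simp only [e]
    rw [integral_const_mul]
    have hd : ((k - n).factorial : ℝ) * (k.descFactorial n : ℝ) = k.factorial := by
      exact_mod_cast Nat.factorial_mul_descFactorial hnk
    have hkn : ((k - n).factorial : ℝ) ≠ 0 := by positivity
    rw [← hd]; field_simp
  · intro n _
    refine nice_integrable (hm F hF) (hgF F hF) ?_
    have : Continuous fun x => pairE ζ x := by rw [coe_pairE]; exact (innerSL ℝ ζ).continuous
    fun_prop

end EM
end

/-- Local Euler–Maclaurin formula: for a rational polytope `P` and a
polynomial function `h`, `∑_{x ∈ P ∩ Λ} h(x) = ∑_{f ∈ F(P)} ∫_f D(P,f)·h`, where the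
integral over each face uses the canonical lattice Lebesgue measure on its affine span, and
`D(P,f)` is the infinite-order constant-coefficient differential operator whose symbol is
`μ(t(P,f))` (extended to `V^*` by `Q`-orthogonal projection). -/
theorem statement15 (d : ℕ) (Λ : AddSubgroup (Vd d)) (hΛ : IsFullLattice Λ)
    (Q : Vd d →ₗ[ℝ] Vd d →ₗ[ℝ] ℝ) (hQ : IsRatInner Λ Q)
    (I S μ : AddSubgroup (Vd d) → Set (Vd d) → Vd d → ℝ)
    (hI : IsIFamily Q Λ I) (hS : IsSFamily Q Λ S) (hμ : IsMuFamily Λ Q I S μ)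
    (P : Set (Vd d)) (hP : IsRatPolyhedron Λ P) (hPb : Bornology.IsBounded P)
    (h : Vd d → ℝ) (hh : IsPolyFun h)
    (π : Set (Vd d) → (Vd d →ₗ[ℝ] Vd d))
    (hπ : ∀ F, IsFaceOf P F → IsQCoproj Q (affineSpan ℝ F).direction (π F))
    (m : Set (Vd d) → MeasureTheory.Measure (Vd d))
    (hm : ∀ F, IsFaceOf P F →
      IsCanonicalMeasure Λ ((affineSpan ℝ F : AffineSubspace ℝ (Vd d)) : Set (Vd d)) (m F))
    (ser : Set (Vd d) → FormalMultilinearSeries ℝ (Vd d) ℝ)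
    (hser : ∀ F, IsFaceOf P F →
      HasFPowerSeriesAt
        (μ (AddSubgroup.map (π F).toAddMonoidHom Λ) ((π F) '' suppCone P F)) (ser F) 0) :
    ∑ᶠ x ∈ P ∩ (Λ : Set (Vd d)), h x
      = ∑ᶠ F ∈ {F | IsFaceOf P F}, ∫ x in F, DOp (ser F) h x ∂(m F) := by
  obtain ⟨n, φ, c, hφ, hPe⟩ := hP
  have hPe' : P = EM.HP φ (fun i => (c i : ℝ)) := by
    rw [hPe, hΛ.2]
    ext x
    simp [EM.HP]
  clear hPe
  subst hPe'
  obtain ⟨p, hp⟩ := hh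
  have hhe : h = fun x : Vd d => MvPolynomial.eval (fun i => x i) p := funext hp
  subst hhe
  have hexp := EM.exp_identity hΛ hφ hPb (hI Λ (EM.quot_self Q Λ)) (hS Λ (EM.quot_self Q Λ)) hμ.1
    π hπ m hm (fun F hF => ⟨ser F, hser F hF⟩)
  obtain ⟨R, hR⟩ := hPb.subset_closedBall 0
  have hPm : MeasurableSet (EM.HP φ (fun i => (c i : ℝ))) := EM.HP_closed.measurableSet
  have hmF : ∀ F, F ∈ (EM.faces_finite (φ := φ) (c := fun i => (c i : ℝ))).toFinset →
      IsFaceOf (EM.HP φ (fun i => (c i : ℝ))) F := by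
    intro F hF; simpa using hF
  have hgF : ∀ F ∈ (EM.faces_finite (φ := φ) (c := fun i => (c i : ℝ))).toFinset,
      EM.Nice (EM.ind F) R := fun F hF =>
    EM.ind_nice (EM.face_closed (hmF F hF)) ((EM.face_sub (hmF F hF)).trans hR)
  have hpw := EM.pw_of_exp _ (EM.nuL Λ) (EM.nuL_FB hΛ) m (fun F hF => EM.canon_FB (hm F (hmF F hF)))
    _ (fun F => EM.ind F) (EM.ind_nice hPm hR) hgF ser _ (fun F hF => hser F (hmF F hF)) hexp
  have hfin := EM.poly_ind _ (EM.nuL Λ) (EM.nuL_FB hΛ) m (fun F hF => EM.canon_FB (hm F (hmF F hF)))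
    _ (fun F => EM.ind F) (EM.ind_nice hPm hR) hgF ser hpw p
  rw [EM.ind_mul, integral_indicator hPm, EM.nuL_finsum hΛ hPm hPb] at hfin
  rw [hfin, finsum_mem_eq_finite_toFinset_sum _ EM.faces_finite]
  refine Finset.sum_congr rfl fun F hF => ?_
  rw [EM.ind_mul, integral_indicator (EM.face_closed (hmF F hF))]
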